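/- Let g be a quasi-Coxeter element of W, i.e., g has a reduced reflection factorization of length rank(W) whose factors generate W. (i) If W = S_n (so g is an n-cycle, with the transpositions as reflections), then the number Fred(g) of reduced reflection factorizations of g equals n^{n−2}. (ii) If W = G(m,1,n) with m > 1 (so the underlying permutation of g is an n-cycle and its color generates ℤ/mℤ), then Fred(g) = n^n. (iii) If W = G(m,m,n) with m > 1, and the underlying permutation of g consists of two cycles of lengths a and b (a + b = n) whose colors generate ℤ/mℤ, then Fred(g) = m · (n−1) · C(n−2; a−1, b−1) · a^a · b^b, where C(n−2; a−1, b−1) is the multinomial coefficient (n−2)!/((a−1)!(b−1)!). -/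

import Mathlib

open scoped Classical

namespace Comb

variable {G : Type*} [Group G]

/-- Reflection length of `g` with respect to a set `R` of "reflections". -/
noncomputable def rLen (R : Set G) (g : G) : ℕ :=
  sInf {k | ∃ l : List G, (∀ x ∈ l, x ∈ R) ∧ l.prod = g ∧ l.length = k}

/-- Reduced reflection factorizations of `g` with respect to `R`. -/
def Red (R : Set G) (g : G) : Set (List G) :=
  {l | (∀ x ∈ l, x ∈ R) ∧ l.prod = g ∧ l.length = rLen R g}

/-- Relative generating sets of `g` with respect to the reflections `R` of a group
`H` of rank `rk`: sets of `rk - ℓ_R(g)` reflections which together with the factors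
of some reduced reflection factorization of `g` generate `H`. -/
def RGS (R : Set G) (H : Subgroup G) (rk : ℕ) (g : G) : Set (Finset G) :=
  {S | ↑S ⊆ R ∧ S.card = rk - rLen R g ∧
    ∃ l ∈ Red R g, Subgroup.closure (↑S ∪ {x | x ∈ l}) = H}

end Comb

/-- The wreath product `G(m,1,n) = (ℤ/mℤ) ≀ S_n`: pairs `[u; a]` of a permutation
`u` of `{1,…,n}` and a tuple of colors `a : Fin n → ℤ/mℤ`. -/
@[ext] structure GW (m n : ℕ) where
  perm : Equiv.Perm (Fin n)
  col : Fin n → ZMod m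

namespace GW

variable {m n : ℕ}

instance : Mul (GW m n) :=
  ⟨fun x y => ⟨x.perm * y.perm, fun k => x.col (y.perm k) + y.col k⟩⟩
instance : One (GW m n) := ⟨⟨1, 0⟩⟩
instance : Inv (GW m n) :=
  ⟨fun x => ⟨x.perm⁻¹, fun k => -(x.col (x.perm⁻¹ k))⟩⟩

@[simp] lemma mul_perm (x y : GW m n) : (x * y).perm = x.perm * y.perm := rfl
@[simp] lemma mul_col (x y : GW m n) (k : Fin n) :
    (x * y).col k = x.col (y.perm k) + y.col k := rfl
@[simp] lemma one_perm : (1 : GW m n).perm = 1 := rfl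
@[simp] lemma one_col (k : Fin n) : (1 : GW m n).col k = 0 := rfl
@[simp] lemma inv_perm (x : GW m n) : (x⁻¹).perm = x.perm⁻¹ := rfl
@[simp] lemma inv_col (x : GW m n) (k : Fin n) :
    (x⁻¹).col k = -(x.col (x.perm⁻¹ k)) := rfl

instance : Group (GW m n) where
  mul_assoc x y z := by
    ext k
    · simp [mul_assoc]
    · simp [add_assoc]
  one_mul x := by ext k <;> simp
  mul_one x := by ext k <;> simp
  inv_mul_cancel x := by
    ext k
    · simp
    · simp

/-- The transposition-like reflection `[(i j); c(e_i - e_j)]`. -/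
def transRefl (i j : Fin n) (c : ZMod m) : GW m n :=
  ⟨Equiv.swap i j, fun l => if l = i then c else if l = j then -c else 0⟩

/-- The diagonal reflection `[id; c e_i]`. -/
def diagRefl (i : Fin n) (c : ZMod m) : GW m n :=
  ⟨1, fun l => if l = i then c else 0⟩

/-- The reflections of `G(m,1,n)`. -/
def reflG1 : Set (GW m n) :=
  {t | (∃ i j c, i ≠ j ∧ t = transRefl i j c) ∨ ∃ i c, c ≠ 0 ∧ t = diagRefl i c}

/-- The reflections of `G(m,m,n)`: the transposition-like reflections. -/
def reflGmm : Set (GW m n) :=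
  {t | ∃ i j c, i ≠ j ∧ t = transRefl i j c}

/-- The subgroup `G(m,m,n)` of `G(m,1,n)`: elements of total color `0`. -/
def Gmm (m n : ℕ) : Subgroup (GW m n) where
  carrier := {x | ∑ k, x.col k = 0}
  one_mem' := by simp
  mul_mem' := by
    intro a b ha hb
    simp only [Set.mem_setOf_eq] at ha hb ⊢
    simp only [mul_col, Finset.sum_add_distrib]
    rw [Equiv.sum_comp b.perm a.col, ha, hb, add_zero]
  inv_mem' := by
    intro x hx
    simp only [Set.mem_setOf_eq] at hx ⊢
    simp only [inv_col, Finset.sum_neg_distrib]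
    rw [Equiv.sum_comp x.perm⁻¹ x.col, hx, neg_zero]

/-- The cycle (orbit) of `x` under the permutation `u`, fixed points included. -/
noncomputable def orbit (u : Equiv.Perm (Fin n)) (x : Fin n) : Finset (Fin n) :=
  Finset.univ.filter fun y => u.SameCycle x y

/-- The color of the cycle of `g` containing `x`. -/
noncomputable def cycColor (g : GW m n) (x : Fin n) : ZMod m :=
  ∑ y ∈ orbit g.perm x, g.col y

end GW

section AlgPart
open Finset

/-- `n^n / n!`. -/
noncomputable def bet (n : ℕ) : ℚ := (n : ℚ) ^ n / n.factorial

/-- `n^(n-1) / n!`, with value `0` at `0`. -/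
noncomputable def tau (n : ℕ) : ℚ := bet n / n

lemma bet_zero : bet 0 = 1 := by simp [bet]
lemma tau_zero : tau 0 = 0 := by simp [tau]
lemma bet_one : bet 1 = 1 := by simp [bet]
lemma tau_one : tau 1 = 1 := by simp [tau, bet]
lemma bet_pos (n : ℕ) : 0 < bet n := by
  unfold bet
  rcases Nat.eq_zero_or_pos n with rfl | h
  · simp
  · positivity
lemma tau_pos (n : ℕ) (h : 0 < n) : 0 < tau n := by
  unfold tau
  have := bet_pos n
  positivity
lemma mul_tau (n : ℕ) (h : 0 < n) : (n : ℚ) * tau n = bet n := by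
  unfold tau; field_simp

lemma abel_inner (q : ℕ) (hq : 2 ≤ q) :
    ∑ j ∈ range (q + 1), (-1 : ℚ) ^ (q - j) * q.choose j * (j : ℚ) ^ (q - 1) = 0 := by
  have h := congrFun (fwdDiff_iter_pow_eq_zero_of_lt (R := ℚ) (n := q) (j := q - 1) (by omega)) 0
  rw [fwdDiff_iter_eq_sum_shift] at h
  simpa using h

lemma abel_inner' (p k : ℕ) (hk : k < p + 1) :
    ∑ j ∈ range (p + 1), (p.choose j : ℚ) * (p - j).choose k * ((j : ℚ) ^ j / j) *
      (-j : ℚ) ^ (p - j - k) = if k + 1 = p then (p : ℚ) else 0 := by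
  have h1 : ∀ j ∈ range (p + 1), (p.choose j : ℚ) * (p - j).choose k * ((j : ℚ) ^ j / j) *
      (-j : ℚ) ^ (p - j - k) = if j = 0 then 0 else
        p.choose k * ((-1 : ℚ) ^ (p - k - j) * (p - k).choose j * (j : ℚ) ^ (p - k - 1)) := by
    intro j hj
    rw [mem_range] at hj
    split_ifs with h0
    · subst h0; simp
    · rcases Nat.lt_or_ge p (j + k) with hlt | hle
      · rw [Nat.choose_eq_zero_of_lt (show p - j < k by omega),
          Nat.choose_eq_zero_of_lt (show p - k < j by omega)]; simp
      · have hc : p.choose j * (p - j).choose k = p.choose k * (p - k).choose j := by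
          have e1 := Nat.choose_mul (n := p) (k := j + k) (s := j) (by omega)
          have e2 := Nat.choose_mul (n := p) (k := j + k) (s := k) (by omega)
          have e3 : (j + k).choose j = (j + k).choose k := Nat.choose_symm_add
          rw [e3, e2] at e1
          simp only [Nat.add_sub_cancel_left, Nat.add_sub_cancel] at e1
          exact e1.symm
        have hc' : (p.choose j : ℚ) * (p - j).choose k = p.choose k * (p - k).choose j := by
          exact_mod_cast hc
        have hj0 : (j : ℚ) ≠ 0 := by exact_mod_cast h0
        have e4 : (j : ℚ) ^ j / j = (j : ℚ) ^ (j - 1) := by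
          obtain ⟨j', rfl⟩ : ∃ j', j = j' + 1 := ⟨j - 1, by omega⟩
          rw [pow_succ]; field_simp; simp
        rw [hc', e4, neg_pow, show p - k - 1 = (j - 1) + (p - j - k) by omega, pow_add,
          show p - k - j = p - j - k by omega]
        ring
  rw [sum_congr rfl h1]
  have h2 : ∑ j ∈ range (p + 1), (if j = 0 then 0 else
        (p.choose k : ℚ) * ((-1 : ℚ) ^ (p - k - j) * (p - k).choose j * (j : ℚ) ^ (p - k - 1)))
      = ∑ j ∈ range (p - k + 1), (if j = 0 then 0 else
        (p.choose k : ℚ) * ((-1 : ℚ) ^ (p - k - j) * (p - k).choose j * (j : ℚ) ^ (p - k - 1))) := by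
    symm
    apply sum_subset
    · intro x; simp only [mem_range]; omega
    · intro x _ hx
      rw [mem_range, not_lt] at hx
      rw [Nat.choose_eq_zero_of_lt (show p - k < x by omega)]; simp
  rw [h2]
  rcases Nat.lt_or_ge (p - k) 2 with hlt | hge
  · rcases (show p - k = 0 ∨ p - k = 1 by omega) with h | h
    · rw [if_neg (by omega), h]; simp
    · rw [if_pos (by omega), h]
      have : p = k + 1 := by omega
      subst this
      simp [sum_range_succ]
  · rw [if_neg (by omega)]
    have h3 : ∀ j ∈ range (p - k + 1), (if j = 0 then 0 else
        (p.choose k : ℚ) * ((-1 : ℚ) ^ (p - k - j) * (p - k).choose j * (j : ℚ) ^ (p - k - 1)))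
        = (p.choose k : ℚ) *
          ((-1 : ℚ) ^ (p - k - j) * (p - k).choose j * (j : ℚ) ^ (p - k - 1)) := by
      intro j _
      split_ifs with h0
      · subst h0
        rw [Nat.cast_zero, zero_pow (by omega)]; simp
      · rfl
    rw [sum_congr rfl h3, ← mul_sum, abel_inner _ hge, mul_zero]

lemma abel_choose (p : ℕ) (hp : 0 < p) :
    ∑ j ∈ range (p + 1), (p.choose j : ℚ) * ((j : ℚ) ^ j / j) * ((p - j : ℕ) : ℚ) ^ (p - j)
      = (p : ℚ) ^ p := by
  have h1 : ∀ j ∈ range (p + 1),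
      (p.choose j : ℚ) * ((j : ℚ) ^ j / j) * ((p - j : ℕ) : ℚ) ^ (p - j)
      = ∑ k ∈ range (p + 1), (p : ℚ) ^ k * ((p.choose j : ℚ) * (p - j).choose k *
        ((j : ℚ) ^ j / j) * (-j : ℚ) ^ (p - j - k)) := by
    intro j hj
    rw [mem_range] at hj
    have : ((p - j : ℕ) : ℚ) = (p : ℚ) + (-j : ℚ) := by
      rw [Nat.cast_sub (by omega)]; ring
    rw [this, add_pow, mul_sum]
    have h2 : ∀ k ∈ range (p - j + 1), (p.choose j : ℚ) * ((j : ℚ) ^ j / j) *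
        ((p : ℚ) ^ k * (-j : ℚ) ^ (p - j - k) * (p - j).choose k)
        = (p : ℚ) ^ k * ((p.choose j : ℚ) * (p - j).choose k *
        ((j : ℚ) ^ j / j) * (-j : ℚ) ^ (p - j - k)) := by
      intro k _; ring
    rw [sum_congr rfl h2]
    apply sum_subset
    · intro x; simp only [mem_range]; omega
    · intro x _ hx
      rw [mem_range, not_lt] at hx
      rw [Nat.choose_eq_zero_of_lt (show p - j < x by omega)]; simp
  rw [sum_congr rfl h1, sum_comm]
  have h3 : ∀ k ∈ range (p + 1), ∑ j ∈ range (p + 1), (p : ℚ) ^ k * ((p.choose j : ℚ) *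
      (p - j).choose k * ((j : ℚ) ^ j / j) * (-j : ℚ) ^ (p - j - k))
      = if k + 1 = p then (p : ℚ) ^ k * p else 0 := by
    intro k hk
    rw [← mul_sum, abel_inner' p k (mem_range.1 hk)]
    split_ifs <;> simp
  rw [sum_congr rfl h3, sum_eq_single (p - 1)]
  · rw [if_pos (by omega), ← pow_succ, show p - 1 + 1 = p by omega]
  · intro b _ hb; rw [if_neg (by omega)]
  · intro h; exfalso; apply h; rw [mem_range]; omega

lemma abel_anti (p : ℕ) (hp : 0 < p) :
    ∑ x ∈ antidiagonal p, tau x.1 * bet x.2 = bet p := by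
  rw [Nat.sum_antidiagonal_eq_sum_range_succ (fun i j => tau i * bet j)]
  have h := abel_choose p hp
  have hb : bet p = (p : ℚ) ^ p / p.factorial := rfl
  rw [hb, ← h, sum_div]
  apply sum_congr rfl
  intro j hj
  rw [mem_range] at hj
  rw [Nat.cast_choose ℚ (show j ≤ p by omega)]
  unfold tau bet
  have := Nat.factorial_ne_zero p
  field_simp

open PowerSeries in
/-- scaled tree series -/
noncomputable def TS (R : Type*) [CommRing R] [Algebra ℚ R] (r : R) : PowerSeries R :=
  PowerSeries.mk fun n => r ^ n * algebraMap ℚ R (tau n)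

noncomputable def BS (R : Type*) [CommRing R] [Algebra ℚ R] (r : R) : PowerSeries R :=
  PowerSeries.mk fun n => r ^ n * algebraMap ℚ R (bet n)

/-- Euler operator. -/
noncomputable def eul {R : Type*} [CommRing R] (f : PowerSeries R) : PowerSeries R :=
  PowerSeries.X * PowerSeries.derivative R f

section
variable {R : Type*} [CommRing R]

lemma coeff_eul (f : PowerSeries R) (n : ℕ) :
    PowerSeries.coeff n (eul f) = n * PowerSeries.coeff n f := by
  unfold eul
  cases n with
  | zero => simp
  | succ k => rw [PowerSeries.coeff_succ_X_mul, PowerSeries.coeff_derivative]; push_cast; ring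

lemma eul_mul (f g : PowerSeries R) : eul (f * g) = f * eul g + g * eul f := by
  unfold eul; rw [Derivation.leibniz]; simp only [smul_eq_mul]; ring
lemma eul_add (f g : PowerSeries R) : eul (f + g) = eul f + eul g := by
  unfold eul; rw [map_add]; ring
lemma eul_sub (f g : PowerSeries R) : eul (f - g) = eul f - eul g := by
  unfold eul; rw [map_sub]; ring
lemma eul_one : eul (1 : PowerSeries R) = 0 := by
  unfold eul; simp
lemma eul_C (r : R) : eul (PowerSeries.C r) = 0 := by
  unfold eul; simp

variable [Algebra ℚ R]

lemma BS_mul (r : R) : BS R r * TS R r = BS R r - 1 := by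
  ext n
  rw [mul_comm, PowerSeries.coeff_mul]
  simp only [TS, BS, PowerSeries.coeff_mk, map_sub, PowerSeries.coeff_one]
  split_ifs with h
  · subst h; simp [tau_zero, bet_zero]
  · rw [sub_zero, ← abel_anti n (by omega), map_sum, mul_sum]
    apply sum_congr rfl
    intro x hx
    rw [Finset.HasAntidiagonal.mem_antidiagonal] at hx
    rw [← hx, pow_add, map_mul]; ring

lemma eul_TS (r : R) : eul (TS R r) = BS R r - 1 := by
  ext n
  rw [coeff_eul]
  simp only [TS, BS, PowerSeries.coeff_mk, map_sub, PowerSeries.coeff_one]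
  split_ifs with h
  · subst h; simp [bet_zero]
  · rw [← mul_tau n (by omega), map_mul, map_natCast]; ring

lemma eul_BS (r : R) : eul (BS R r) = BS R r ^ 2 * (BS R r - 1) := by
  have h := congrArg eul (BS_mul r)
  rw [eul_mul, eul_sub, eul_one, eul_TS] at h
  have h2 := BS_mul r
  linear_combination (-BS R r) * h + eul (BS R r) * h2

end

lemma tau_conv (p : ℕ) :
    (p : ℚ) * ∑ x ∈ antidiagonal p, tau x.1 * tau x.2 = 2 * (p - 1) * tau p := by
  have h1 := BS_mul (R := ℚ) 1
  have h2 := eul_TS (R := ℚ) 1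
  have h3 : eul (TS ℚ 1 * TS ℚ 1) = 2 * (eul (TS ℚ 1) - TS ℚ 1) := by
    rw [eul_mul, h2]; linear_combination 2 * h1
  have h4 := congrArg (PowerSeries.coeff p) h3
  rw [coeff_eul, PowerSeries.coeff_mul, two_mul, map_add, map_sub, coeff_eul] at h4
  simp only [TS, PowerSeries.coeff_mk, one_pow, one_mul, Algebra.algebraMap_self,
    RingHom.id_apply] at h4
  rw [h4]; ring

end AlgPart
section Annulus
open Finset


/-- `∑ a/(a+b) β a β b x^a`. -/
noncomputable def KS : PowerSeries (Polynomial ℚ) :=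
  PowerSeries.mk fun n => ∑ x ∈ antidiagonal n,
    Polynomial.monomial x.1 ((x.1 : ℚ) / (x.1 + x.2) * (bet x.1 * bet x.2))

noncomputable def KS' : PowerSeries (Polynomial ℚ) :=
  PowerSeries.mk fun n => ∑ x ∈ antidiagonal n,
    Polynomial.monomial x.1 ((x.2 : ℚ) / (x.1 + x.2) * (bet x.1 * bet x.2))

noncomputable def QS : PowerSeries (Polynomial ℚ) :=
  PowerSeries.mk fun n => ∑ x ∈ antidiagonal n, Polynomial.monomial x.1 (tau n)

lemma coeff_BB (n : ℕ) : PowerSeries.coeff n (BS (Polynomial ℚ) Polynomial.X * BS (Polynomial ℚ) 1) =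
    ∑ x ∈ antidiagonal n, Polynomial.monomial x.1 (bet x.1 * bet x.2) := by
  rw [PowerSeries.coeff_mul]
  apply sum_congr rfl
  intro x hx
  simp only [BS, PowerSeries.coeff_mk, one_pow, one_mul]
  rw [← Polynomial.C_mul_X_pow_eq_monomial, map_mul, Polynomial.algebraMap_eq]; ring

lemma KS_add : KS + KS' = BS (Polynomial ℚ) Polynomial.X * BS (Polynomial ℚ) 1 - 1 := by
  ext1 n
  rw [map_add, map_sub, coeff_BB]
  simp only [KS, KS', PowerSeries.coeff_mk, PowerSeries.coeff_one]
  split_ifs with h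
  · subst h; simp [bet_zero]
  · rw [← sum_add_distrib, sub_zero]
    apply sum_congr rfl
    intro x hx
    rw [Finset.HasAntidiagonal.mem_antidiagonal] at hx
    rw [← map_add]
    congr 1
    have : (x.1 : ℚ) + x.2 ≠ 0 := by
      have : ((x.1 + x.2 : ℕ) : ℚ) ≠ 0 := by rw [hx]; exact_mod_cast h
      push_cast at this; exact this
    field_simp

lemma eul_KS : eul KS = eul (BS (Polynomial ℚ) Polynomial.X) * BS (Polynomial ℚ) 1 := by
  ext1 n
  rw [PowerSeries.coeff_mul, coeff_eul]
  simp only [KS, PowerSeries.coeff_mk]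
  rw [mul_sum]
  apply sum_congr rfl
  intro x hx
  rw [Finset.HasAntidiagonal.mem_antidiagonal] at hx
  rw [coeff_eul]
  simp only [BS, PowerSeries.coeff_mk, one_pow, one_mul]
  rw [← Polynomial.C_mul_X_pow_eq_monomial, Polynomial.algebraMap_eq]
  have e : ((n : ℕ) : (Polynomial ℚ)) = Polynomial.C (n : ℚ) := by simp
  have e' : ((x.1 : ℕ) : (Polynomial ℚ)) = Polynomial.C (x.1 : ℚ) := by simp
  rw [e, e', ← mul_assoc, ← map_mul]
  have : (n : ℚ) * (x.1 / (x.1 + x.2) * (bet x.1 * bet x.2)) = x.1 * bet x.1 * bet x.2 := by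
    have hn : (n : ℚ) = x.1 + x.2 := by rw [← hx]; push_cast; ring
    rw [← hn]
    rcases Nat.eq_zero_or_pos n with h0 | h0
    · have : x.1 = 0 := by omega
      simp [this]
    · field_simp
  rw [this, map_mul, map_mul]; ring

lemma QS_mul : (PowerSeries.C (Polynomial.X : (Polynomial ℚ)) - 1) * QS =
    PowerSeries.C (Polynomial.X : (Polynomial ℚ)) * TS (Polynomial ℚ) Polynomial.X - TS (Polynomial ℚ) 1 := by
  ext1 n
  rw [sub_mul, one_mul, map_sub, map_sub, PowerSeries.coeff_C_mul, PowerSeries.coeff_C_mul]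
  simp only [QS, TS, PowerSeries.coeff_mk, one_pow, one_mul]
  rw [Nat.sum_antidiagonal_eq_sum_range_succ (fun i _ => Polynomial.monomial i (tau n))]
  have : ∑ k ∈ range n.succ, Polynomial.monomial k (tau n)
      = (∑ k ∈ range (n + 1), (Polynomial.X : (Polynomial ℚ)) ^ k) * Polynomial.C (tau n) := by
    rw [sum_mul]
    apply sum_congr rfl
    intro k _
    rw [← Polynomial.C_mul_X_pow_eq_monomial]; ring
  rw [this, Polynomial.algebraMap_eq]
  have h := geom_sum_mul (Polynomial.X : (Polynomial ℚ)) (n + 1)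
  linear_combination Polynomial.C (tau n) * h

lemma eul_QS : eul QS = (QS - TS (Polynomial ℚ) Polynomial.X * TS (Polynomial ℚ) 1) * (BS (Polynomial ℚ) Polynomial.X * BS (Polynomial ℚ) 1) := by
  have hne : (PowerSeries.C (Polynomial.X : (Polynomial ℚ)) - 1) ≠ 0 := by
    intro h
    have h2 := congrArg (PowerSeries.coeff 0) h
    simp at h2
    have h3 := congrArg (Polynomial.eval 0) h2
    simp at h3
  apply mul_left_cancel₀ hne
  have h := congrArg eul QS_mul
  rw [eul_sub, eul_mul, eul_mul, eul_sub, eul_C, eul_one, eul_TS, eul_TS] at h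
  have hx := BS_mul (R := (Polynomial ℚ)) Polynomial.X
  have hy := BS_mul (R := (Polynomial ℚ)) 1
  have hq := QS_mul
  generalize BS (Polynomial ℚ) Polynomial.X = A at *
  generalize BS (Polynomial ℚ) 1 = B at *
  generalize TS (Polynomial ℚ) Polynomial.X = u at *
  generalize TS (Polynomial ℚ) 1 = v at *
  generalize PowerSeries.C (Polynomial.X : (Polynomial ℚ)) = x at *
  generalize QS = Q at *
  linear_combination h - A * B * hq - (x * B - (x-1) * v * B) * hx + (A + (x-1)*(A-1)) * hy

noncomputable def WS : PowerSeries (Polynomial ℚ) :=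
  (TS (Polynomial ℚ) Polynomial.X - TS (Polynomial ℚ) 1) * KS - (BS (Polynomial ℚ) Polynomial.X - 1 + TS (Polynomial ℚ) 1 - QS)

lemma eul_WS : eul WS = WS * (BS (Polynomial ℚ) Polynomial.X * BS (Polynomial ℚ) 1) := by
  unfold WS
  rw [eul_sub, eul_mul, eul_sub, eul_sub, eul_add, eul_sub, eul_TS, eul_TS, eul_one, eul_KS,
    eul_QS, eul_BS]
  have hx := BS_mul (R := (Polynomial ℚ)) Polynomial.X
  have hy := BS_mul (R := (Polynomial ℚ)) 1
  generalize BS (Polynomial ℚ) Polynomial.X = A at *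
  generalize BS (Polynomial ℚ) 1 = B at *
  generalize TS (Polynomial ℚ) Polynomial.X = u at *
  generalize TS (Polynomial ℚ) 1 = v at *
  generalize QS = Q at *
  generalize KS = K at *
  linear_combination (A * (A - 1) - K) * (B * hx - A * hy) - v * B * hx - (A - 1) * hy + A * hy

lemma WS_zero : WS = 0 := by
  have key : ∀ n, PowerSeries.coeff n WS = 0 := by
    intro n
    induction n using Nat.strong_induction_on with
    | _ n ih =>
      rcases (show n = 0 ∨ n = 1 ∨ 2 ≤ n by omega) with h | h | h
      · subst h
        simp [WS, TS, KS, BS, QS, tau_zero, bet_zero]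
      · subst h
        simp only [WS, map_sub, map_add, PowerSeries.coeff_mul,
          show antidiagonal 1 = {((0:ℕ), (1:ℕ)), (1, 0)} from rfl]
        simp [TS, KS, BS, QS, tau_zero, bet_zero, tau_one, bet_one, PowerSeries.coeff_one,
          show antidiagonal 1 = {((0:ℕ), (1:ℕ)), (1, 0)} from rfl]
        rw [← Polynomial.C_mul_X_pow_eq_monomial]
        simp only [map_one, pow_one, one_mul]
        ring
      · have h1 := congrArg (PowerSeries.coeff n) eul_WS
        rw [coeff_eul, PowerSeries.coeff_mul, sum_eq_single (n, 0)] at h1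
        · have h2 : PowerSeries.coeff 0 (BS (Polynomial ℚ) Polynomial.X * BS (Polynomial ℚ) 1) = 1 := by
            simp [BS, bet_zero]
          simp only [h2] at h1
          have h3 : ((n : (Polynomial ℚ)) - 1) * PowerSeries.coeff n WS = 0 := by
            linear_combination h1
          rcases mul_eq_zero.1 h3 with h4 | h4
          · exfalso
            have : ((n : ℕ) : (Polynomial ℚ)) = ((1 : ℕ) : (Polynomial ℚ)) := by
              push_cast; linear_combination h4
            have := Nat.cast_injective this
            omega
          · exact h4
        · intro x hx hne
          rw [Finset.HasAntidiagonal.mem_antidiagonal] at hx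
          have : x.1 < n := by
            by_contra hc
            apply hne
            ext <;> simp <;> omega
          rw [ih _ this, zero_mul]
        · intro hc; exfalso; apply hc
          rw [Finset.HasAntidiagonal.mem_antidiagonal]; simp
  ext1 n
  rw [key]; simp

lemma KS_eq : KS + KS' = QS + TS (Polynomial ℚ) Polynomial.X * KS + TS (Polynomial ℚ) 1 * KS' := by
  have h1 := KS_add
  have h2 := WS_zero
  unfold WS at h2
  have hx := BS_mul (R := (Polynomial ℚ)) Polynomial.X
  have hy := BS_mul (R := (Polynomial ℚ)) 1
  generalize BS (Polynomial ℚ) Polynomial.X = A at *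
  generalize BS (Polynomial ℚ) 1 = B at *
  generalize TS (Polynomial ℚ) Polynomial.X = u at *
  generalize TS (Polynomial ℚ) 1 = v at *
  generalize QS = Q at *
  generalize KS = K at *
  generalize KS' = K' at *
  linear_combination (1 - v) * h1 - h2 - A * hy

lemma coeff_hom (f : ℕ → ℕ → ℚ) (l i : ℕ) :
    (∑ x ∈ antidiagonal l, Polynomial.monomial x.1 (f x.1 x.2)).coeff i
      = if i ≤ l then f i (l - i) else 0 := by
  rw [Polynomial.finsetSum_coeff]
  simp only [Polynomial.coeff_monomial]
  rw [Nat.sum_antidiagonal_eq_sum_range_succ (fun a b => if a = i then f a b else 0)]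
  rw [sum_ite_eq' (range l.succ) i]
  simp only [mem_range, Nat.lt_succ_iff]

lemma coeff_TX_mul (f : ℕ → ℕ → ℚ) (a b : ℕ) :
    (PowerSeries.coeff (a + b) (TS (Polynomial ℚ) Polynomial.X * PowerSeries.mk fun n =>
      ∑ x ∈ antidiagonal n, Polynomial.monomial x.1 (f x.1 x.2))).coeff a
      = ∑ x ∈ antidiagonal a, tau x.1 * f x.2 b := by
  rw [PowerSeries.coeff_mul, Polynomial.finsetSum_coeff]
  simp only [TS, PowerSeries.coeff_mk]
  rw [Nat.sum_antidiagonal_eq_sum_range_succ_mk, Nat.sum_antidiagonal_eq_sum_range_succ_mk]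
  have h1 : ∀ k ∈ range (a + b).succ, (Polynomial.X ^ k * algebraMap ℚ (Polynomial ℚ) (tau k) *
      ∑ x ∈ antidiagonal (a + b - k), Polynomial.monomial x.1 (f x.1 x.2)).coeff a
      = if k ≤ a then tau k * f (a - k) b else 0 := by
    intro k hk
    rw [mul_assoc, Polynomial.coeff_X_pow_mul', Polynomial.algebraMap_eq,
      Polynomial.coeff_C_mul, coeff_hom]
    split_ifs with h1 h2
    · rw [show a + b - k - (a - k) = b by omega]
    · exfalso; omega
    · rfl
  rw [sum_congr rfl h1, ← sum_filter]
  apply sum_congr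
  · ext k; simp only [mem_filter, mem_range]; omega
  · intros; rfl

lemma coeff_T1_mul (f : ℕ → ℕ → ℚ) (a b : ℕ) :
    (PowerSeries.coeff (a + b) (TS (Polynomial ℚ) 1 * PowerSeries.mk fun n =>
      ∑ x ∈ antidiagonal n, Polynomial.monomial x.1 (f x.1 x.2))).coeff a
      = ∑ x ∈ antidiagonal b, tau x.1 * f a x.2 := by
  rw [PowerSeries.coeff_mul, Polynomial.finsetSum_coeff]
  simp only [TS, PowerSeries.coeff_mk, one_pow, one_mul]
  rw [Nat.sum_antidiagonal_eq_sum_range_succ_mk, Nat.sum_antidiagonal_eq_sum_range_succ_mk]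
  have h1 : ∀ k ∈ range (a + b).succ, (algebraMap ℚ (Polynomial ℚ) (tau k) *
      ∑ x ∈ antidiagonal (a + b - k), Polynomial.monomial x.1 (f x.1 x.2)).coeff a
      = if k ≤ b then tau k * f a (b - k) else 0 := by
    intro k hk
    rw [mem_range] at hk
    rw [Polynomial.algebraMap_eq, Polynomial.coeff_C_mul, coeff_hom]
    by_cases h : k ≤ b
    · rw [if_pos h, if_pos (by omega), show a + b - k - a = b - k by omega]
    · rw [if_neg h, if_neg (by omega), mul_zero]
  rw [sum_congr rfl h1, ← sum_filter]
  apply sum_congr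
  · ext k; simp only [mem_filter, mem_range]; omega
  · intros; rfl

lemma annulus (a b : ℕ) (hab : 0 < a + b) :
    bet a * bet b = tau (a + b)
      + ∑ x ∈ antidiagonal a, tau x.1 * ((x.2 : ℚ) / (x.2 + b) * (bet x.2 * bet b))
      + ∑ x ∈ antidiagonal b, tau x.1 * ((x.2 : ℚ) / (a + x.2) * (bet a * bet x.2)) := by
  have h := congrArg (fun F => (PowerSeries.coeff (a + b) F).coeff a) KS_eq
  simp only [map_add, Polynomial.coeff_add] at h
  have e1 : (PowerSeries.coeff (a + b) (TS (Polynomial ℚ) Polynomial.X * KS)).coeff a = _ :=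
    coeff_TX_mul (fun i j : ℕ => (i : ℚ) / (i + j) * (bet i * bet j)) a b
  have e2 : (PowerSeries.coeff (a + b) (TS (Polynomial ℚ) 1 * KS')).coeff a = _ :=
    coeff_T1_mul (fun i j : ℕ => (j : ℚ) / (i + j) * (bet i * bet j)) a b
  rw [e1, e2] at h
  simp only [KS, KS', QS, PowerSeries.coeff_mk] at h
  rw [coeff_hom (fun i j : ℕ => (i : ℚ) / (i + j) * (bet i * bet j)),
    coeff_hom (fun i j : ℕ => (j : ℚ) / (i + j) * (bet i * bet j)),
    coeff_hom (fun i j : ℕ => tau (a + b))] at h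
  simp only [if_pos (show a ≤ a + b by omega), Nat.add_sub_cancel_left] at h
  rw [← h]
  have : (a : ℚ) + b ≠ 0 := by exact_mod_cast hab.ne'
  field_simp

end Annulus
section MultisetPart
open Finset

/-- The join-cut recursion on multisets of (cycle length, cycle color). -/
noncomputable def NN (m : ℕ) [NeZero m] (δ : ℚ) : ℕ → Multiset (ℕ × ZMod m) → ℚ
  | 0, M => if ∀ x ∈ M, x = (1, 0) then 1 else 0
  | k + 1, M =>
    (M.map fun x => (x.1 : ℚ) * ∑ s ∈ Ico 1 x.1, ∑ e : ZMod m,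
      NN m δ k ((s, e) ::ₘ (x.1 - s, x.2 - e) ::ₘ M.erase x)).sum / 2
    + (M.map fun x => ((M.erase x).map fun y => (x.1 : ℚ) * y.1 * m *
      NN m δ k ((x.1 + y.1, x.2 + y.2) ::ₘ (M.erase x).erase y)).sum).sum / 2
    + δ * (M.map fun x => (x.1 : ℚ) * ∑ e ∈ univ.erase x.2,
      NN m δ k ((x.1, e) ::ₘ M.erase x)).sum

/-- total size -/
def msz {m : ℕ} (M : Multiset (ℕ × ZMod m)) : ℕ := (M.map Prod.fst).sum
/-- number of zero colored cycles -/
noncomputable def mk0 {m : ℕ} (M : Multiset (ℕ × ZMod m)) : ℕ := M.countP (fun x => x.2 = 0)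

variable {m : ℕ}

lemma msz_cons (x : ℕ × ZMod m) (M) : msz (x ::ₘ M) = x.1 + msz M := by simp [msz]
lemma mk0_cons (x : ℕ × ZMod m) (M) : mk0 (x ::ₘ M) = mk0 M + if x.2 = 0 then 1 else 0 := by
  simp [mk0, Multiset.countP_cons]

lemma msum_zero {α : Type*} (M : Multiset α) (f : α → ℚ) (h : ∀ x ∈ M, f x = 0) :
    (M.map f).sum = 0 := by
  rw [Multiset.map_congr rfl h]; simp

variable [NeZero m] {δ : ℚ}

lemma NN_vanish (k : ℕ) : ∀ M : Multiset (ℕ × ZMod m), k + mk0 M < msz M → NN m δ k M = 0 := by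
  induction k with
  | zero =>
    intro M hM
    rw [NN, if_neg]
    intro hall
    have hM' : M = Multiset.replicate (Multiset.card M) (1, 0) :=
      Multiset.eq_replicate_card.2 hall
    rw [hM'] at hM
    have h1 : msz (Multiset.replicate (Multiset.card M) ((1, 0) : ℕ × ZMod m))
      = Multiset.card M := by simp [msz]
    have h2 : mk0 (Multiset.replicate (Multiset.card M) ((1, 0) : ℕ × ZMod m))
      = Multiset.card M := by
        unfold mk0
        rw [Multiset.countP_eq_card.2]
        · simp
        · intro x hx; rw [Multiset.eq_of_mem_replicate hx]
    omega
  | succ k ih =>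
    intro M hM
    rw [NN, msum_zero, msum_zero, msum_zero]
    · simp
    · intro x hx
      obtain ⟨E, rfl⟩ := Multiset.exists_cons_of_mem hx
      rw [sum_eq_zero, mul_zero]
      intro e _
      apply ih
      rw [Multiset.erase_cons_head]
      rw [msz_cons, mk0_cons] at *
      simp only
      split_ifs at * <;> omega
    · intro x hx
      apply msum_zero
      intro y hy
      obtain ⟨E, rfl⟩ := Multiset.exists_cons_of_mem hx
      rw [Multiset.erase_cons_head] at *
      obtain ⟨E, rfl⟩ := Multiset.exists_cons_of_mem hy
      rw [Multiset.erase_cons_head] at *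
      rw [ih, mul_zero]
      simp only [msz_cons, mk0_cons] at *
      split_ifs at * <;> omega
    · intro x hx
      obtain ⟨E, rfl⟩ := Multiset.exists_cons_of_mem hx
      rw [sum_eq_zero, mul_zero]
      intro s hs
      rw [mem_Ico] at hs
      apply sum_eq_zero
      intro e _
      rw [Multiset.erase_cons_head] at *
      apply ih
      simp only [msz_cons, mk0_cons] at *
      have : e = 0 → x.2 - e = 0 → x.2 = 0 := by
        intro h1 h2; rw [h1] at h2; simpa using h2
      split_ifs at * <;> first | omega | (exfalso; tauto)

/-- splitting a zero cycle -/
lemma split_zero (k p s : ℕ) (E : Multiset (ℕ × ZMod m)) (hs : s ∈ Ico 1 p)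
    (h : k + 1 + mk0 ((p, 0) ::ₘ E) = msz ((p, 0) ::ₘ E)) :
    ∑ e : ZMod m, NN m δ k ((s, e) ::ₘ (p - s, 0 - e) ::ₘ E)
      = NN m δ k ((s, 0) ::ₘ (p - s, 0) ::ₘ E) := by
  rw [mem_Ico] at hs
  rw [sum_eq_single 0]
  · simp
  · intro e _ he
    apply NN_vanish
    simp only [msz_cons, mk0_cons] at *
    rw [if_neg he, if_neg (by simpa using he)]
    simp only [if_true] at h
    omega
  · simp

/-- splitting a nonzero cycle -/
lemma split_nonzero (k p s : ℕ) (d : ZMod m) (hd : d ≠ 0) (E : Multiset (ℕ × ZMod m))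
    (hs : s ∈ Ico 1 p) (h : k + 1 + mk0 ((p, d) ::ₘ E) = msz ((p, d) ::ₘ E)) :
    ∑ e : ZMod m, NN m δ k ((s, e) ::ₘ (p - s, d - e) ::ₘ E)
      = NN m δ k ((s, 0) ::ₘ (p - s, d) ::ₘ E) + NN m δ k ((s, d) ::ₘ (p - s, 0) ::ₘ E) := by
  rw [mem_Ico] at hs
  rw [← sum_subset (subset_univ {0, d})]
  · rw [sum_pair hd.symm]; simp
  · intro e _ he
    simp only [mem_insert, mem_singleton, not_or] at he
    apply NN_vanish
    simp only [msz_cons, mk0_cons] at *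
    rw [if_neg he.1, if_neg (by rw [sub_eq_zero]; exact fun h => he.2 h.symm)]
    rw [if_neg hd] at h
    omega

lemma merge_vanish (k : ℕ) (x y : ℕ × ZMod m) (E : Multiset (ℕ × ZMod m))
    (hxy : x.2 = 0 ∨ y.2 = 0) (h : k + 1 + mk0 (x ::ₘ y ::ₘ E) = msz (x ::ₘ y ::ₘ E)) :
    NN m δ k ((x.1 + y.1, x.2 + y.2) ::ₘ E) = 0 := by
  apply NN_vanish
  simp only [msz_cons, mk0_cons] at *
  rcases hxy with h0 | h0
  · rw [h0] at *; simp only [zero_add, if_true] at *; omega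
  · rw [h0] at *; simp only [add_zero, if_true] at *; omega

lemma merge_vanish' (k : ℕ) (M : Multiset (ℕ × ZMod m)) (x y : ℕ × ZMod m) (hx : x ∈ M)
    (hy : y ∈ M.erase x) (hxy : x.2 = 0 ∨ y.2 = 0) (h : k + 1 + mk0 M = msz M) :
    (x.1 : ℚ) * y.1 * m * NN m δ k ((x.1 + y.1, x.2 + y.2) ::ₘ (M.erase x).erase y) = 0 := by
  rw [merge_vanish, mul_zero]
  · exact hxy
  · rw [Multiset.cons_erase hy, Multiset.cons_erase hx]; exact h

lemma diag_vanish (k p : ℕ) (d e : ZMod m) (E : Multiset (ℕ × ZMod m)) (he : e ≠ 0)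
    (h : k + 1 + mk0 ((p, d) ::ₘ E) = msz ((p, d) ::ₘ E)) :
    NN m δ k ((p, e) ::ₘ E) = 0 := by
  apply NN_vanish
  simp only [msz_cons, mk0_cons] at *
  rw [if_neg he]
  omega

/-- zero colored cycles -/
def zc (m : ℕ) (p : ℕ) : ℕ × ZMod m := (p, 0)

lemma zc_inj : Function.Injective (zc m) := fun a b h => (Prod.mk.inj h).1

lemma msz_add (A B : Multiset (ℕ × ZMod m)) : msz (A + B) = msz A + msz B := by simp [msz]
lemma mk0_add (A B : Multiset (ℕ × ZMod m)) : mk0 (A + B) = mk0 A + mk0 B := by simp [mk0]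
lemma msz_zc (Z : Multiset ℕ) : msz (Z.map (zc m)) = Z.sum := by
  unfold msz
  rw [Multiset.map_map]
  exact congrArg Multiset.sum (Multiset.map_id Z)
lemma mk0_zc (Z : Multiset ℕ) : mk0 (Z.map (zc m)) = Multiset.card Z := by
  unfold mk0
  rw [Multiset.countP_eq_card.2]
  · simp
  · intro x hx
    obtain ⟨p, _, rfl⟩ := Multiset.mem_map.1 hx
    rfl

lemma sum_Ico_anti (p : ℕ) (f : ℕ → ℕ → ℚ) (h0 : f 0 p = 0) (hp : f p 0 = 0) :
    ∑ x ∈ HasAntidiagonal.antidiagonal p, f x.1 x.2 = ∑ s ∈ Ico 1 p, f s (p - s) := by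
  rw [Nat.sum_antidiagonal_eq_sum_range_succ f]
  symm
  apply sum_subset
  · intro s; simp only [mem_Ico, mem_range]; omega
  · intro s h1 h2
    simp only [mem_Ico, mem_range] at h1 h2
    rcases (show s = 0 ∨ s = p by omega) with h | h
    · rw [h]; simpa using h0
    · rw [h]; simpa using hp

lemma sum_Ico_refl (p : ℕ) (f : ℕ → ℕ → ℚ) :
    ∑ s ∈ Ico 1 p, f s (p - s) = ∑ s ∈ Ico 1 p, f (p - s) s := by
  apply sum_nbij' (fun s => p - s) (fun s => p - s)
  · intro s; simp only [mem_Ico]; omega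
  · intro s; simp only [mem_Ico]; omega
  · intro s; simp only [mem_Ico]; omega
  · intro s; simp only [mem_Ico]; omega
  · intro s hs; simp only [mem_Ico] at hs; rw [show p - (p - s) = s by omega]

lemma tau_Ico (p : ℕ) : (p : ℚ) * ∑ s ∈ Ico 1 p, tau s * tau (p - s) = 2 * (p - 1) * tau p := by
  rw [← tau_conv, sum_Ico_anti p (fun a b => tau a * tau b)]
  · simp [tau_zero]
  · simp [tau_zero]

lemma sum_pred (Z : Multiset ℕ) :
    (Z.map fun p : ℕ => (p : ℚ) - 1).sum = Z.sum - Multiset.card Z := by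
  induction Z using Multiset.induction_on with
  | empty => simp
  | cons a s ih =>
    simp only [Multiset.map_cons, Multiset.sum_cons, ih, Multiset.card_cons]; push_cast; ring

/-- contribution of the splittings of zero colored cycles -/
lemma zsplit (k : ℕ) (A : Multiset (ℕ × ZMod m)) (hA : mk0 A = 0) (h : ℚ) (Z : Multiset ℕ)
    (hZ : ∀ p ∈ Z, 0 < p)
    (ih : ∀ Z' : Multiset ℕ, (∀ p ∈ Z', 0 < p) → k + Multiset.card Z' = msz A + Z'.sum →
      NN m δ k (A + Z'.map (zc m)) = k.factorial * h * (Z'.map tau).prod)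
    (hk : k + 1 + Multiset.card Z = msz A + Z.sum) :
    ((Z.map (zc m)).map fun x => (x.1 : ℚ) * ∑ s ∈ Ico 1 x.1, ∑ e : ZMod m,
      NN m δ k ((s, e) ::ₘ (x.1 - s, x.2 - e) ::ₘ (A + Z.map (zc m)).erase x)).sum
    = 2 * k.factorial * h * (Z.map tau).prod * ((Z.sum : ℚ) - Multiset.card Z) := by
  rw [Multiset.map_map, ← sum_pred, ← Multiset.sum_map_mul_left]
  congr 1
  apply Multiset.map_congr rfl
  intro p hp
  obtain ⟨Y, rfl⟩ := Multiset.exists_cons_of_mem hp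
  simp only [Function.comp]
  have e1 : (A + (p ::ₘ Y).map (zc m)).erase (zc m p) = A + Y.map (zc m) := by
    rw [Multiset.map_cons, Multiset.add_cons, Multiset.erase_cons_head]
  rw [e1]
  have e2 : ∀ s ∈ Ico 1 p, ∑ e : ZMod m,
      NN m δ k ((s, e) ::ₘ ((zc m p).1 - s, (zc m p).2 - e) ::ₘ (A + Y.map (zc m)))
      = k.factorial * h * (Y.map tau).prod * (tau s * tau (p - s)) := by
    intro s hs
    have := split_zero (δ := δ) k p s (A + Y.map (zc m)) hs (by
      simp only [msz_cons, mk0_cons, msz_add, mk0_add, msz_zc, mk0_zc, hA]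
      simp only [Multiset.card_cons, Multiset.sum_cons, if_true] at hk ⊢
      omega)
    simp only [zc] at this ⊢
    rw [this]
    have e3 := ih (s ::ₘ (p - s) ::ₘ Y) (by
      rw [mem_Ico] at hs
      intro q hq
      simp only [Multiset.mem_cons] at hq
      rcases hq with hq | hq | hq
      · omega
      · omega
      · exact hZ q (Multiset.mem_cons_of_mem hq)) (by
      rw [mem_Ico] at hs
      simp only [Multiset.card_cons, Multiset.sum_cons] at hk ⊢
      omega)
    simp only [Multiset.map_cons, Multiset.add_cons, Multiset.prod_cons, zc] at e3
    rw [e3]; ring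
  change (p : ℚ) * ∑ s ∈ Ico 1 p, _ = _
  rw [sum_congr rfl e2, ← mul_sum]
  have := tau_Ico p
  rw [Multiset.map_cons, Multiset.prod_cons]
  linear_combination (k.factorial * h * (Y.map tau).prod) * this

lemma zdiag (k : ℕ) (A : Multiset (ℕ × ZMod m)) (hA : mk0 A = 0) (Z : Multiset ℕ)
    (hk : k + 1 + Multiset.card Z = msz A + Z.sum) :
    ((Z.map (zc m)).map fun x => (x.1 : ℚ) * ∑ e ∈ univ.erase x.2,
      NN m δ k ((x.1, e) ::ₘ (A + Z.map (zc m)).erase x)).sum = 0 := by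
  apply msum_zero
  intro x hx
  rw [sum_eq_zero, mul_zero]
  intro e he
  have hx0 : x.2 = 0 := by
    obtain ⟨p, _, rfl⟩ := Multiset.mem_map.1 hx
    rfl
  rw [hx0, mem_erase] at he
  apply diag_vanish k x.1 x.2 e _ he.1
  rw [Prod.mk.eta, Multiset.cons_erase (Multiset.mem_add.2 (Or.inr hx))]
  rw [mk0_add, msz_add, mk0_zc, msz_zc, hA]; omega

lemma formA (k : ℕ) : ∀ Z : Multiset ℕ, (∀ p ∈ Z, 0 < p) → k + Multiset.card Z = Z.sum →
    NN m δ k (Z.map (zc m)) = k.factorial * (Z.map tau).prod := by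
  induction k with
  | zero =>
    intro Z hZ hk
    have h1 : ∀ p ∈ Z, p = 1 := by
      induction Z using Multiset.induction_on with
      | empty => simp
      | cons a s ih =>
        have hs : Multiset.card s ≤ s.sum := by
          have := Multiset.card_nsmul_le_sum (s := s) (a := 1)
            (fun x hx => hZ x (Multiset.mem_cons_of_mem hx))
          simpa using this
        have ha := hZ a (Multiset.mem_cons_self a s)
        simp only [Multiset.card_cons, Multiset.sum_cons] at hk
        intro p hp
        rcases Multiset.mem_cons.1 hp with rfl | hp
        · omega
        · exact ih (fun p hp => hZ p (Multiset.mem_cons_of_mem hp)) (by omega) p hp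
    rw [NN, if_pos]
    · have : (Z.map tau).prod = 1 := by
        apply Multiset.prod_eq_one
        intro x hx
        obtain ⟨p, hp, rfl⟩ := Multiset.mem_map.1 hx
        rw [h1 p hp, tau_one]
      rw [this]; simp
    · intro x hx
      obtain ⟨p, hp, rfl⟩ := Multiset.mem_map.1 hx
      rw [h1 p hp]; rfl
  | succ k ih =>
    intro Z hZ hk
    rw [NN]
    have h1 := zsplit (m := m) (δ := δ) k 0 (by simp [mk0]) 1 Z hZ (by
      intro Z' hZ' hk'
      rw [zero_add, ih Z' hZ' (by simpa [msz] using hk')]; ring) (by simpa [msz] using hk)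
    have h2 := zdiag (m := m) (δ := δ) k 0 (by simp [mk0]) Z (by simpa [msz] using hk)
    rw [zero_add] at h1 h2
    rw [h1, h2, msum_zero]
    · rw [← hk, Nat.factorial_succ]; push_cast; ring
    · intro x hx
      apply msum_zero
      intro y hy
      apply merge_vanish' k _ x y hx hy
      · obtain ⟨p, _, rfl⟩ := Multiset.mem_map.1 hx
        exact Or.inl rfl
      · rw [mk0_zc, msz_zc]; exact hk

lemma bet_Ico (p : ℕ) (hp : 0 < p) :
    ∑ s ∈ Ico 1 p, tau s * bet (p - s) + tau p = bet p := by
  have h := abel_anti p hp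
  rw [Nat.sum_antidiagonal_eq_sum_range_succ (fun i j => tau i * bet j), sum_range_succ,
    range_eq_Ico, sum_eq_sum_Ico_succ_bot hp] at h
  simpa [tau_zero, bet_zero] using h

lemma form1 (d : ZMod m) (hd : d ≠ 0) (k : ℕ) : ∀ (p : ℕ) (Z : Multiset ℕ), 0 < p →
    (∀ p ∈ Z, 0 < p) → k + Multiset.card Z = p + Z.sum →
    NN m 1 k ((p, d) ::ₘ Z.map (zc m)) = k.factorial * bet p * (Z.map tau).prod := by
  induction k with
  | zero =>
    intro p Z hp hZ hk
    exfalso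
    have := Multiset.card_nsmul_le_sum (s := Z) (a := 1) (fun x hx => hZ x hx)
    simp only [smul_eq_mul, mul_one] at this
    omega
  | succ k ih =>
    intro p Z hp hZ hk
    have hM : k + 1 + mk0 ((p, d) ::ₘ Z.map (zc m)) = msz ((p, d) ::ₘ Z.map (zc m)) := by
      rw [msz_cons, mk0_cons, msz_zc, mk0_zc, if_neg hd]; exact hk
    have h1 := zsplit (m := m) (δ := 1) k {(p, d)}
      (by rw [← Multiset.cons_zero, mk0_cons, if_neg hd]; rfl) (bet p) Z hZ (by
      intro Z' hZ' hk'
      rw [Multiset.singleton_add, ih p Z' hp hZ' (by simpa [msz] using hk')])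
      (by simpa [msz] using hk)
    have h2 := zdiag (m := m) (δ := 1) k {(p, d)}
      (by rw [← Multiset.cons_zero, mk0_cons, if_neg hd]; rfl) Z (by simpa [msz] using hk)
    rw [Multiset.singleton_add] at h1 h2
    rw [NN]
    rw [msum_zero _ (fun x => (Multiset.map _ _).sum)]
    · rw [Multiset.map_cons, Multiset.map_cons, Multiset.sum_cons, Multiset.sum_cons, h1, h2]
      simp only [Multiset.erase_cons_head]
      have e1 : ∀ s ∈ Ico 1 p, ∑ e : ZMod m,
          NN m 1 k ((s, e) ::ₘ (p - s, d - e) ::ₘ Z.map (zc m))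
          = k.factorial * (Z.map tau).prod * (tau s * bet (p - s))
            + k.factorial * (Z.map tau).prod * (bet s * tau (p - s)) := by
        intro s hs
        rw [split_nonzero k p s d hd _ hs hM]
        rw [mem_Ico] at hs
        have i1 := ih (p - s) (s ::ₘ Z) (by omega) (by
          intro q hq
          rcases Multiset.mem_cons.1 hq with hq | hq
          · omega
          · exact hZ q hq) (by simp only [Multiset.card_cons, Multiset.sum_cons]; omega)
        have i2 := ih s ((p - s) ::ₘ Z) (by omega) (by
          intro q hq
          rcases Multiset.mem_cons.1 hq with hq | hq
          · omega
          · exact hZ q hq) (by simp only [Multiset.card_cons, Multiset.sum_cons]; omega)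
        simp only [Multiset.map_cons, Multiset.prod_cons, zc] at i1 i2
        rw [Multiset.cons_swap, i1, i2]; ring
      rw [sum_congr rfl e1, sum_add_distrib, ← mul_sum, ← mul_sum,
        sum_Ico_refl p (fun a b => bet a * tau b)]
      have e2 : ∑ e ∈ univ.erase d, NN m 1 k ((p, e) ::ₘ Z.map (zc m))
          = k.factorial * (tau p * (Z.map tau).prod) := by
        rw [sum_eq_single 0]
        · have := formA (m := m) (δ := 1) k (p ::ₘ Z) (by
            intro q hq
            rcases Multiset.mem_cons.1 hq with hq | hq
            · omega
            · exact hZ q hq) (by simp only [Multiset.card_cons, Multiset.sum_cons]; omega)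
          simpa [zc] using this
        · intro e _ he
          exact diag_vanish k p d e _ he hM
        · intro hc; exfalso; apply hc; simp [hd.symm]
      rw [e2]
      have e3 := bet_Ico p hp
      have e4 : ∑ s ∈ Ico 1 p, bet (p - s) * tau s = ∑ s ∈ Ico 1 p, tau s * bet (p - s) :=
        sum_congr rfl fun s _ => mul_comm _ _
      rw [e4]
      have hk' : (k : ℚ) + 1 + Multiset.card Z = p + Z.sum := by exact_mod_cast hk
      rw [Nat.factorial_succ]; simp only [Nat.cast_mul, Nat.cast_add, Nat.cast_one]
      linear_combination (p * k.factorial * (Z.map tau).prod) * e3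
        - (k.factorial * bet p * (Z.map tau).prod) * hk'
    · intro x hx
      apply msum_zero
      intro y hy
      apply merge_vanish' k _ x y hx hy _ hM
      rcases Multiset.mem_cons.1 hx with rfl | hx
      · rw [Multiset.erase_cons_head] at hy
        obtain ⟨p, _, rfl⟩ := Multiset.mem_map.1 hy
        exact Or.inr rfl
      · obtain ⟨p, _, rfl⟩ := Multiset.mem_map.1 hx
        exact Or.inl rfl

/-- weight of a pair of nonzero cycles -/
noncomputable def HH (m p q : ℕ) : ℚ := m / (p + q) * (p * q * bet p * bet q)

lemma HH_rec (m p q : ℕ) (hp : 0 < p) (hq : 0 < q) :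
    ((p : ℚ) + q) * HH m p q = p * q * m * tau (p + q)
      + p * ∑ s ∈ Ico 1 p, tau s * HH m (p - s) q
      + q * ∑ s ∈ Ico 1 q, tau s * HH m p (q - s) := by
  have h := annulus p q (by omega)
  rw [sum_Ico_anti p (fun a b => tau a * ((b : ℚ) / (b + q) * (bet b * bet q)))
      (by simp [tau_zero]) (by simp),
    sum_Ico_anti q (fun a b => tau a * ((b : ℚ) / (p + b) * (bet p * bet b)))
      (by simp [tau_zero]) (by simp)] at h
  have hl : ((p : ℚ) + q) * HH m p q = m * p * q * (bet p * bet q) := by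
    unfold HH
    have : (p : ℚ) + q ≠ 0 := by positivity
    field_simp
  have e1 : ∑ s ∈ Ico 1 p, tau s * HH m (p - s) q = m * q * ∑ s ∈ Ico 1 p,
      tau s * (((p - s : ℕ) : ℚ) / ((p - s : ℕ) + q) * (bet (p - s) * bet q)) := by
    rw [mul_sum]
    apply sum_congr rfl
    intro s _
    unfold HH; ring
  have e2 : ∑ s ∈ Ico 1 q, tau s * HH m p (q - s) = m * p * ∑ s ∈ Ico 1 q,
      tau s * (((q - s : ℕ) : ℚ) / (p + (q - s : ℕ)) * (bet p * bet (q - s))) := by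
    rw [mul_sum]
    apply sum_congr rfl
    intro s _
    unfold HH; ring
  rw [hl, e1, e2]
  linear_combination (m * p * q : ℚ) * h

lemma HH_symm (m p q : ℕ) : HH m p q = HH m q p := by
  unfold HH; rw [add_comm (p : ℚ)]; ring

lemma formB (k : ℕ) : ∀ (d : ZMod m) (_ : d ≠ 0) (p q : ℕ) (Z : Multiset ℕ), 0 < p → 0 < q →
    (∀ p ∈ Z, 0 < p) → k + Multiset.card Z = p + q + Z.sum →
    NN m 0 k ((p, d) ::ₘ (q, -d) ::ₘ Z.map (zc m))
      = k.factorial * HH m p q * (Z.map tau).prod := by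
  induction k with
  | zero =>
    intro d hd p q Z hp hq hZ hk
    exfalso
    have := Multiset.card_nsmul_le_sum (s := Z) (a := 1) (fun x hx => hZ x hx)
    simp only [smul_eq_mul, mul_one] at this
    omega
  | succ k ih =>
    -- contribution of the splittings of the first nonzero cycle
    have key : ∀ (d : ZMod m) (_ : d ≠ 0) (p q : ℕ) (Z : Multiset ℕ), 0 < p → 0 < q →
        (∀ p ∈ Z, 0 < p) → k + 1 + Multiset.card Z = p + q + Z.sum →
        ∑ s ∈ Ico 1 p, ∑ e : ZMod m,
          NN m 0 k ((s, e) ::ₘ (p - s, d - e) ::ₘ ((q, -d) ::ₘ Z.map (zc m)))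
          = 2 * k.factorial * (Z.map tau).prod * ∑ s ∈ Ico 1 p, tau s * HH m (p - s) q := by
      intro d hd p q Z hp hq hZ hk
      have hM : k + 1 + mk0 ((p, d) ::ₘ (q, -d) ::ₘ Z.map (zc m))
          = msz ((p, d) ::ₘ (q, -d) ::ₘ Z.map (zc m)) := by
        rw [msz_cons, mk0_cons, msz_cons, mk0_cons, msz_zc, mk0_zc, if_neg hd,
          if_neg (by simpa using hd)]
        simp only; omega
      have e1 : ∀ s ∈ Ico 1 p, ∑ e : ZMod m,
          NN m 0 k ((s, e) ::ₘ (p - s, d - e) ::ₘ ((q, -d) ::ₘ Z.map (zc m)))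
          = k.factorial * (Z.map tau).prod * (tau s * HH m (p - s) q)
            + k.factorial * (Z.map tau).prod * (HH m s q * tau (p - s)) := by
        intro s hs
        rw [split_nonzero k p s d hd _ hs hM]
        rw [mem_Ico] at hs
        have i1 := ih d hd (p - s) q (s ::ₘ Z) (by omega) hq (by
          intro q hq
          rcases Multiset.mem_cons.1 hq with hq | hq
          · omega
          · exact hZ q hq) (by simp only [Multiset.card_cons, Multiset.sum_cons]; omega)
        have i2 := ih d hd s q ((p - s) ::ₘ Z) (by omega) hq (by
          intro q hq
          rcases Multiset.mem_cons.1 hq with hq | hq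
          · omega
          · exact hZ q hq) (by simp only [Multiset.card_cons, Multiset.sum_cons]; omega)
        simp only [Multiset.map_cons, Multiset.prod_cons, zc] at i1 i2
        rw [Multiset.cons_swap (s, 0), Multiset.cons_swap (s, 0), i1,
          Multiset.cons_swap (p - s, 0), i2]; ring
      rw [sum_congr rfl e1, sum_add_distrib, ← mul_sum, ← mul_sum,
        sum_Ico_refl p (fun a b => HH m a q * tau b)]
      have e4 : ∑ s ∈ Ico 1 p, HH m (p - s) q * tau s = ∑ s ∈ Ico 1 p, tau s * HH m (p - s) q :=
        sum_congr rfl fun s _ => mul_comm _ _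
      rw [e4]; ring
    intro d hd p q Z hp hq hZ hk
    have hd' : -d ≠ 0 := by simpa using hd
    have hM : k + 1 + mk0 ((p, d) ::ₘ (q, -d) ::ₘ Z.map (zc m))
        = msz ((p, d) ::ₘ (q, -d) ::ₘ Z.map (zc m)) := by
      rw [msz_cons, mk0_cons, msz_cons, mk0_cons, msz_zc, mk0_zc, if_neg hd, if_neg hd']
      simp only; omega
    have h1 := zsplit (m := m) (δ := 0) k {(p, d), (q, -d)}
      (by
        rw [Multiset.insert_eq_cons, ← Multiset.cons_zero, mk0_cons, mk0_cons,
          if_neg hd, if_neg hd']; rfl) (HH m p q) Z hZ (by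
      intro Z' hZ' hk'
      rw [Multiset.insert_eq_cons, Multiset.cons_add, Multiset.singleton_add,
        ih d hd p q Z' hp hq hZ' (by simpa [msz] using hk')])
      (by simpa [msz] using hk)
    rw [Multiset.insert_eq_cons, Multiset.cons_add, Multiset.singleton_add] at h1
    have hsw : ((p, d) ::ₘ (q, -d) ::ₘ Z.map (zc m)) = ((q, -d) ::ₘ (p, d) ::ₘ Z.map (zc m)) :=
      Multiset.cons_swap _ _ _
    have er1 : ((p, d) ::ₘ (q, -d) ::ₘ Z.map (zc m)).erase (p, d) = (q, -d) ::ₘ Z.map (zc m) :=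
      Multiset.erase_cons_head _ _
    have er2 : ((p, d) ::ₘ (q, -d) ::ₘ Z.map (zc m)).erase (q, -d) = (p, d) ::ₘ Z.map (zc m) := by
      rw [hsw]; exact Multiset.erase_cons_head _ _
    have s1 := key d hd p q Z hp hq hZ hk
    have s2 := key (-d) hd' q p Z hq hp hZ (by omega)
    rw [neg_neg] at s2
    have hA := formA (m := m) (δ := 0) k ((p + q) ::ₘ Z) (by
      intro q hq
      rcases Multiset.mem_cons.1 hq with hq | hq
      · omega
      · exact hZ q hq) (by simp only [Multiset.card_cons, Multiset.sum_cons]; omega)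
    simp only [Multiset.map_cons, Multiset.prod_cons, zc] at hA
    -- merges
    have g1 : (((p, d) ::ₘ (q, -d) ::ₘ Z.map (zc m)).map fun x =>
        ((((p, d) ::ₘ (q, -d) ::ₘ Z.map (zc m)).erase x).map fun y => (x.1 : ℚ) * y.1 * m *
        NN m 0 k ((x.1 + y.1, x.2 + y.2) ::ₘ
          (((p, d) ::ₘ (q, -d) ::ₘ Z.map (zc m)).erase x).erase y)).sum).sum
        = 2 * (p * q * m * (k.factorial * (tau (p + q) * (Z.map tau).prod))) := by
      rw [Multiset.map_cons, Multiset.sum_cons, Multiset.map_cons, Multiset.sum_cons,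
        msum_zero (Z.map (zc m))]
      · rw [er1, er2, Multiset.map_cons, Multiset.sum_cons, Multiset.map_cons, Multiset.sum_cons,
          Multiset.erase_cons_head, Multiset.erase_cons_head, msum_zero (Z.map (zc m)),
          msum_zero (Z.map (zc m))]
        · simp only [add_neg_cancel, neg_add_cancel]
          rw [add_comm q p]
          rw [hA]; ring
        · intro y hy
          have := merge_vanish' (δ := 0) k _ (q, -d) y (by simp)
            (by rw [er2]; exact Multiset.mem_cons_of_mem hy) (Or.inr (by
              obtain ⟨p, _, rfl⟩ := Multiset.mem_map.1 hy
              rfl)) hM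
          rw [er2] at this
          exact this
        · intro y hy
          have := merge_vanish' (δ := 0) k _ (p, d) y (by simp)
            (by rw [er1]; exact Multiset.mem_cons_of_mem hy) (Or.inr (by
              obtain ⟨p, _, rfl⟩ := Multiset.mem_map.1 hy
              rfl)) hM
          rw [er1] at this
          exact this
      · intro x hx
        apply msum_zero
        intro y hy
        refine merge_vanish' k _ x y
          (Multiset.mem_cons_of_mem (Multiset.mem_cons_of_mem hx)) hy (Or.inl ?_) hM
        obtain ⟨p, _, rfl⟩ := Multiset.mem_map.1 hx
        rfl
    rw [NN, g1, Multiset.map_cons, Multiset.sum_cons, Multiset.map_cons, Multiset.sum_cons, h1,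
      er1, er2]
    simp only
    rw [s1, s2]
    have hr := HH_rec m p q hp hq
    have e5 : ∑ s ∈ Ico 1 q, tau s * HH m (q - s) p = ∑ s ∈ Ico 1 q, tau s * HH m p (q - s) :=
      sum_congr rfl fun s _ => by rw [HH_symm]
    rw [e5]
    have hk' : (k : ℚ) + 1 + Multiset.card Z = p + q + Z.sum := by exact_mod_cast hk
    rw [Nat.factorial_succ]; simp only [Nat.cast_mul, Nat.cast_add, Nat.cast_one]
    linear_combination (-(k.factorial * (Z.map tau).prod)) * hr
        - (k.factorial * HH m p q * (Z.map tau).prod) * hk'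

end MultisetPart
section OrbitPart
open Finset GW

variable {n : ℕ}

lemma mem_orbit {u : Equiv.Perm (Fin n)} {x y : Fin n} : y ∈ orbit u x ↔ u.SameCycle x y := by
  simp [orbit]

lemma self_mem_orbit (u : Equiv.Perm (Fin n)) (x : Fin n) : x ∈ orbit u x :=
  mem_orbit.2 (Equiv.Perm.SameCycle.refl u x)

lemma orbit_eq_iff {u : Equiv.Perm (Fin n)} {x y : Fin n} :
    orbit u x = orbit u y ↔ u.SameCycle x y := by
  constructor
  · intro h
    have := self_mem_orbit u y
    rw [← h] at this
    exact mem_orbit.1 this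
  · intro h
    ext z
    rw [mem_orbit, mem_orbit]
    exact ⟨fun h' => h.symm.trans h', fun h' => h.trans h'⟩

/-- The set of cycles, fixed points included. -/
noncomputable def cyc (u : Equiv.Perm (Fin n)) : Finset (Finset (Fin n)) :=
  univ.image (orbit u)

lemma orbit_mem_cyc (u : Equiv.Perm (Fin n)) (x : Fin n) : orbit u x ∈ cyc u :=
  mem_image_of_mem _ (mem_univ x)

lemma orbit_of_mem {u : Equiv.Perm (Fin n)} {C : Finset (Fin n)} (hC : C ∈ cyc u) {x : Fin n}
    (hx : x ∈ C) : orbit u x = C := by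
  obtain ⟨y, _, rfl⟩ := mem_image.1 hC
  exact orbit_eq_iff.2 (mem_orbit.1 hx).symm

lemma apply_mem_orbit {u : Equiv.Perm (Fin n)} {x y : Fin n} :
    u y ∈ orbit u x ↔ y ∈ orbit u x := by
  rw [mem_orbit, mem_orbit, Equiv.Perm.sameCycle_apply_right]

lemma orbit_criterion (u : Equiv.Perm (Fin n)) (i : Fin n) (S : Finset (Fin n)) (hi : i ∈ S)
    (hcl : ∀ x ∈ S, u x ∈ S) (hsc : ∀ x ∈ S, u.SameCycle i x) : orbit u i = S := by
  ext y
  rw [mem_orbit]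
  constructor
  · intro h
    obtain ⟨k, hk⟩ := h.exists_nat_pow_eq
    rw [← hk]
    clear hk
    induction k with
    | zero => simpa using hi
    | succ k ih => rw [pow_succ', Equiv.Perm.mul_apply]; exact hcl _ ih
  · exact hsc y

lemma card_fiber (u : Equiv.Perm (Fin n)) {C : Finset (Fin n)} (hC : C ∈ cyc u) :
    #{a ∈ (univ : Finset (Fin n)) | orbit u a = C} = #C := by
  congr 1
  ext a
  simp only [mem_filter, mem_univ, true_and]
  constructor
  · intro h; rw [← h]; exact self_mem_orbit u a
  · exact fun h => orbit_of_mem hC h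

lemma sum_orbit (u : Equiv.Perm (Fin n)) (f : Finset (Fin n) → ℚ) :
    ∑ i, f (orbit u i) = ∑ C ∈ cyc u, (#C : ℚ) * f C := by
  rw [sum_comp]
  apply sum_congr rfl
  intro C hC
  rw [card_fiber u hC, nsmul_eq_mul]

/-- length of the cycle -/
noncomputable def per (u : Equiv.Perm (Fin n)) (i : Fin n) : ℕ := Function.minimalPeriod u i

lemma per_pos (u : Equiv.Perm (Fin n)) (i : Fin n) : 0 < per u i := by
  apply Function.minimalPeriod_pos_of_mem_periodicPts
  refine ⟨orderOf u, orderOf_pos u, ?_⟩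
  rw [Function.IsPeriodicPt, Function.IsFixedPt, ← Equiv.Perm.coe_pow, pow_orderOf_eq_one]
  rfl

lemma pow_per (u : Equiv.Perm (Fin n)) (i : Fin n) : (u ^ per u i) i = i := by
  rw [Equiv.Perm.coe_pow]
  exact Function.iterate_minimalPeriod

lemma pow_inj (u : Equiv.Perm (Fin n)) (i : Fin n) {r s : ℕ} (hr : r < per u i)
    (hs : s < per u i) (h : (u ^ r) i = (u ^ s) i) : r = s := by
  rw [Equiv.Perm.coe_pow, Equiv.Perm.coe_pow] at h
  exact Function.iterate_injOn_Iio_minimalPeriod hr hs h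

lemma orbit_eq_image (u : Equiv.Perm (Fin n)) (i : Fin n) :
    orbit u i = (range (per u i)).image (fun r => (u ^ r) i) := by
  apply orbit_criterion
  · exact mem_image.2 ⟨0, mem_range.2 (per_pos u i), by simp⟩
  · intro x hx
    obtain ⟨r, hr, rfl⟩ := mem_image.1 hx
    rw [mem_range] at hr
    rw [← Equiv.Perm.mul_apply, ← pow_succ']
    by_cases h : r + 1 < per u i
    · exact mem_image.2 ⟨r + 1, mem_range.2 h, rfl⟩
    · rw [show r + 1 = per u i by omega, pow_per]
      exact mem_image.2 ⟨0, mem_range.2 (per_pos u i), by simp⟩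
  · intro x hx
    obtain ⟨r, hr, rfl⟩ := mem_image.1 hx
    exact ⟨r, by simp⟩

lemma card_orbit (u : Equiv.Perm (Fin n)) (i : Fin n) : #(orbit u i) = per u i := by
  rw [orbit_eq_image, card_image_of_injOn, card_range]
  intro r hr s hs h
  simp only [coe_range, Set.mem_Iio] at hr hs
  exact pow_inj u i hr hs h

/-- sum over the other elements of a cycle -/
lemma sum_orbit_erase (u : Equiv.Perm (Fin n)) (i : Fin n) (f : Fin n → ℚ) :
    ∑ j ∈ (orbit u i).erase i, f j = ∑ s ∈ Ico 1 (per u i), f ((u ^ s) i) := by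
  symm
  apply sum_nbij (fun s => (u ^ s) i)
  · intro s hs
    rw [mem_Ico] at hs
    rw [mem_erase, mem_orbit]
    refine ⟨fun h => ?_, ⟨s, by simp⟩⟩
    have := pow_inj u i hs.2 (per_pos u i) (h.trans (by simp : i = (u ^ 0) i))
    omega
  · intro r hr s hs h
    simp only [coe_Ico, Set.mem_Ico] at hr hs
    exact pow_inj u i hr.2 hs.2 h
  · intro j hj
    rw [mem_coe, mem_erase, orbit_eq_image] at hj
    obtain ⟨r, hr, rfl⟩ := mem_image.1 hj.2
    rw [mem_range] at hr
    refine ⟨r, ?_, rfl⟩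
    rw [mem_coe, mem_Ico]
    refine ⟨?_, hr⟩
    by_contra hc
    apply hj.1
    rw [show r = 0 by omega]; simp
  · intro s _; rfl

/-- splitting a cycle: the piece of `i` -/
lemma split_orbit (u : Equiv.Perm (Fin n)) (i : Fin n) (s : ℕ) (h0 : 0 < s) (hs : s < per u i) :
    orbit (Equiv.swap i ((u ^ s) i) * u) i = (range s).image (fun r => (u ^ r) i) := by
  have step : ∀ r, r + 1 < s →
      (Equiv.swap i ((u ^ s) i) * u) ((u ^ r) i) = (u ^ (r + 1)) i := by
    intro r hr
    rw [Equiv.Perm.mul_apply, ← Equiv.Perm.mul_apply u, ← pow_succ']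
    apply Equiv.swap_apply_of_ne_of_ne
    · intro h
      have := pow_inj u i (by omega) (per_pos u i) (h.trans (by simp : i = (u ^ 0) i))
      omega
    · intro h
      have := pow_inj u i (by omega) hs h
      omega
  apply orbit_criterion
  · exact mem_image.2 ⟨0, mem_range.2 h0, by simp⟩
  · intro x hx
    obtain ⟨r, hr, rfl⟩ := mem_image.1 hx
    rw [mem_range] at hr
    by_cases h : r + 1 < s
    · rw [step r h]
      exact mem_image.2 ⟨r + 1, mem_range.2 h, rfl⟩
    · have : r + 1 = s := by omega
      rw [Equiv.Perm.mul_apply, ← Equiv.Perm.mul_apply u, ← pow_succ', this,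
        Equiv.swap_apply_right]
      exact mem_image.2 ⟨0, mem_range.2 h0, by simp⟩
  · intro x hx
    obtain ⟨r, hr, rfl⟩ := mem_image.1 hx
    rw [mem_range] at hr
    clear hx
    induction r with
    | zero => simpa using Equiv.Perm.SameCycle.refl _ _
    | succ r ih =>
      rw [← step r hr, Equiv.Perm.sameCycle_apply_right]
      exact ih (by omega)

lemma split_orbit_card (u : Equiv.Perm (Fin n)) (i : Fin n) (s : ℕ) (h0 : 0 < s)
    (hs : s < per u i) : #(orbit (Equiv.swap i ((u ^ s) i) * u) i) = s := by
  rw [split_orbit u i s h0 hs, card_image_of_injOn, card_range]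
  intro r hr t ht h
  simp only [coe_range, Set.mem_Iio] at hr ht
  exact pow_inj u i (r := r) (s := t) (by omega) (by omega) h

lemma per_congr {u : Equiv.Perm (Fin n)} {i j : Fin n} (h : u.SameCycle i j) :
    per u i = per u j := by
  rw [← card_orbit, ← card_orbit, orbit_eq_iff.2 h]

lemma exists_pow (u : Equiv.Perm (Fin n)) {i j : Fin n} (h : u.SameCycle i j) (hij : i ≠ j) :
    ∃ s, 0 < s ∧ s < per u i ∧ (u ^ s) i = j := by
  have := mem_orbit.2 h
  rw [orbit_eq_image] at this
  obtain ⟨s, hs, hsj⟩ := mem_image.1 this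
  refine ⟨s, ?_, mem_range.1 hs, hsj⟩
  rcases Nat.eq_zero_or_pos s with rfl | h
  · exact absurd (by simpa using hsj) hij
  · exact h

/-- splitting a cycle: description of the two pieces -/
lemma split_pieces (u : Equiv.Perm (Fin n)) {i j : Fin n} (h : u.SameCycle i j) (hij : i ≠ j) :
    orbit u i = orbit (Equiv.swap i j * u) i ∪ orbit (Equiv.swap i j * u) j ∧
    Disjoint (orbit (Equiv.swap i j * u) i) (orbit (Equiv.swap i j * u) j) := by
  obtain ⟨s, h0, hs, rfl⟩ := exists_pow u h hij
  have hp := per_congr h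
  have hback : (u ^ (per u i - s)) ((u ^ s) i) = i := by
    rw [← Equiv.Perm.mul_apply, ← pow_add, Nat.sub_add_cancel hs.le, pow_per]
  have c1 := split_orbit_card u i s h0 hs
  have c2 := split_orbit_card u ((u ^ s) i) (per u i - s) (by omega) (by omega)
  rw [hback, Equiv.swap_comm] at c2
  have s1 := split_orbit u i s h0 hs
  have s2 := split_orbit u ((u ^ s) i) (per u i - s) (by omega) (by omega)
  rw [hback, Equiv.swap_comm] at s2
  set v := Equiv.swap i ((u ^ s) i) * u with hv
  have hdis : Disjoint (orbit v i) (orbit v ((u ^ s) i)) := by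
    rw [Finset.disjoint_left]
    intro x hx hy
    rw [s1] at hx
    rw [s2] at hy
    obtain ⟨r, hr, rfl⟩ := mem_image.1 hx
    obtain ⟨t, ht, hrt⟩ := mem_image.1 hy
    rw [mem_range] at hr ht
    rw [← Equiv.Perm.mul_apply, ← pow_add] at hrt
    have := pow_inj u i (r := t + s) (s := r) (by omega) (by omega) hrt
    omega
  refine ⟨?_, hdis⟩
  symm
  apply eq_of_subset_of_card_le
  · apply union_subset
    · rw [s1]
      intro x hx
      obtain ⟨r, hr, rfl⟩ := mem_image.1 hx
      exact mem_orbit.2 ⟨r, by simp⟩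
    · rw [s2]
      intro x hx
      obtain ⟨r, hr, rfl⟩ := mem_image.1 hx
      exact mem_orbit.2 (h.trans ⟨r, by simp⟩)
  · rw [card_union_of_disjoint hdis, c1, c2, card_orbit]; omega

lemma orbit_other (u : Equiv.Perm (Fin n)) {i j x : Fin n} (h : u.SameCycle i j)
    (hx : ¬ u.SameCycle i x) : orbit (Equiv.swap i j * u) x = orbit u x := by
  have step : ∀ y, u.SameCycle x y → (Equiv.swap i j * u) y = u y := by
    intro y hy
    rw [Equiv.Perm.mul_apply]
    apply Equiv.swap_apply_of_ne_of_ne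
    · intro e
      apply hx
      rw [← Equiv.Perm.sameCycle_apply_right, e] at hy
      exact hy.symm
    · intro e
      apply hx
      rw [← Equiv.Perm.sameCycle_apply_right, e] at hy
      exact h.trans hy.symm
  apply orbit_criterion
  · exact self_mem_orbit u x
  · intro y hy
    rw [step y (mem_orbit.1 hy)]
    exact apply_mem_orbit.2 hy
  · intro y hy
    obtain ⟨k, rfl⟩ := (mem_orbit.1 hy).exists_nat_pow_eq
    clear hy
    induction k with
    | zero => simpa using Equiv.Perm.SameCycle.refl _ _
    | succ k ih =>
      rw [pow_succ', Equiv.Perm.mul_apply, ← step _ ⟨k, by simp⟩,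
        Equiv.Perm.sameCycle_apply_right]
      exact ih

lemma split_cyc (u : Equiv.Perm (Fin n)) {i j : Fin n} (h : u.SameCycle i j) (hij : i ≠ j) :
    cyc (Equiv.swap i j * u) = insert (orbit (Equiv.swap i j * u) i)
      (insert (orbit (Equiv.swap i j * u) j) ((cyc u).erase (orbit u i))) := by
  obtain ⟨hU, hdis⟩ := split_pieces u h hij
  ext D
  simp only [mem_insert, mem_erase]
  constructor
  · intro hD
    obtain ⟨x, _, rfl⟩ := mem_image.1 hD
    by_cases hx : u.SameCycle i x
    · rw [← mem_orbit, hU, mem_union] at hx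
      rcases hx with hx | hx
      · exact Or.inl (orbit_eq_iff.2 (mem_orbit.1 hx).symm)
      · exact Or.inr (Or.inl (orbit_eq_iff.2 (mem_orbit.1 hx).symm))
    · right; right
      rw [orbit_other u h hx]
      refine ⟨fun e => hx (orbit_eq_iff.1 e).symm, orbit_mem_cyc u x⟩
  · rintro (rfl | rfl | ⟨h1, h2⟩)
    · exact orbit_mem_cyc _ _
    · exact orbit_mem_cyc _ _
    · obtain ⟨x, _, rfl⟩ := mem_image.1 h2
      rw [← orbit_other u h (fun e => h1 (orbit_eq_iff.2 e).symm)]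
      exact orbit_mem_cyc _ _

lemma merge_same (u : Equiv.Perm (Fin n)) {i j : Fin n} (h : ¬ u.SameCycle i j) :
    (Equiv.swap i j * u).SameCycle i j := by
  have step : ∀ r, r < per u i → (Equiv.swap i j * u).SameCycle i ((u ^ r) i) := by
    intro r
    induction r with
    | zero => intro _; simpa using Equiv.Perm.SameCycle.refl _ _
    | succ r ih =>
      intro hr
      have : (Equiv.swap i j * u) ((u ^ r) i) = (u ^ (r + 1)) i := by
        rw [Equiv.Perm.mul_apply, ← Equiv.Perm.mul_apply u, ← pow_succ']
        apply Equiv.swap_apply_of_ne_of_ne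
        · intro e
          have := pow_inj u i hr (per_pos u i) (e.trans (by simp : i = (u ^ 0) i))
          omega
        · intro e
          exact h ⟨(r + 1 : ℕ), by rw [zpow_natCast]; exact e⟩
      rw [← this, Equiv.Perm.sameCycle_apply_right]
      exact ih (by omega)
  have hp := per_pos u i
  have h1 := step (per u i - 1) (by omega)
  rw [← Equiv.Perm.sameCycle_apply_right, Equiv.Perm.mul_apply, ← Equiv.Perm.mul_apply u,
    ← pow_succ', Nat.sub_add_cancel hp, pow_per, Equiv.swap_apply_left] at h1
  exact h1

end OrbitPart
section ColorPart
open Finset GW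

variable {m n : ℕ}

/-- (length, color) of a cycle -/
def fC (g : GW m n) (C : Finset (Fin n)) : ℕ × ZMod m := (#C, ∑ y ∈ C, g.col y)

/-- The multiset of (length, color) of the cycles. -/
noncomputable def MG (g : GW m n) : Multiset (ℕ × ZMod m) := (cyc g.perm).val.map (fC g)

lemma transRefl_symm (i j : Fin n) (c : ZMod m) (hij : i ≠ j) :
    transRefl i j c = transRefl j i (-c) := by
  unfold transRefl
  ext k
  · simp [Equiv.swap_comm]
  · simp only
    split_ifs with h1 h2 h2 <;> simp_all

lemma transRefl_mul_self (i j : Fin n) (c : ZMod m) (hij : i ≠ j) :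
    transRefl i j c * transRefl i j c = 1 := by
  ext k
  · simp [transRefl]
  · simp only [mul_col, one_col]
    simp only [transRefl]
    by_cases h1 : k = i
    · subst h1; simp [hij.symm]
    · by_cases h2 : k = j
      · subst h2; simp [h1]
      · rw [Equiv.swap_apply_of_ne_of_ne h1 h2]; simp [h1, h2]

lemma transRefl_inv (i j : Fin n) (c : ZMod m) (hij : i ≠ j) :
    (transRefl i j c)⁻¹ = transRefl i j c :=
  inv_eq_of_mul_eq_one_left (transRefl_mul_self i j c hij)

lemma diagRefl_inv (i : Fin n) (c : ZMod m) :
    (diagRefl i c)⁻¹ = diagRefl i (-c) := by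
  ext k
  · simp [diagRefl]
  · simp only [inv_col, diagRefl, inv_one, Equiv.Perm.one_apply]
    split_ifs <;> simp

lemma sum_col_trans (g : GW m n) (i j : Fin n) (c : ZMod m) (hij : i ≠ j) (S : Finset (Fin n)) :
    ∑ y ∈ S, (transRefl i j c * g).col y
      = ∑ y ∈ S, g.col y + (if g.perm⁻¹ i ∈ S then c else 0)
        - (if g.perm⁻¹ j ∈ S then c else 0) := by
  have : ∀ y, (transRefl i j c * g).col y = g.col y + (if g.perm⁻¹ i = y then c else 0)
      - (if g.perm⁻¹ j = y then c else 0) := by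
    intro y
    simp only [mul_col, transRefl, Equiv.Perm.inv_eq_iff_eq]
    by_cases h1 : g.perm y = i
    · rw [h1]; simp [hij.symm]; ring
    · by_cases h2 : g.perm y = j
      · rw [h2]; simp [hij, hij.symm]; ring
      · simp [h1, h2, Ne.symm h1, Ne.symm h2]
  simp only [this, sum_sub_distrib, sum_add_distrib, sum_ite_eq]

lemma trans_perm (g : GW m n) (i j : Fin n) (c : ZMod m) :
    (transRefl i j c * g).perm = Equiv.swap i j * g.perm := rfl

lemma inv_mem_orbit {u : Equiv.Perm (Fin n)} {x y : Fin n} :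
    u⁻¹ y ∈ orbit u x ↔ y ∈ orbit u x := by
  rw [mem_orbit, mem_orbit, ← Equiv.Perm.sameCycle_apply_right]
  simp

/-- The effect of cutting a cycle. -/
lemma split_MG (g : GW m n) {i j : Fin n} (c : ZMod m) (h : g.perm.SameCycle i j) (hij : i ≠ j) :
    ∃ E : Multiset (ℕ × ZMod m), MG g = fC g (orbit g.perm i) ::ₘ E ∧
      MG (transRefl i j c * g) = 
        (#(orbit (Equiv.swap i j * g.perm) i),
          ∑ y ∈ orbit (Equiv.swap i j * g.perm) i, g.col y - c) ::ₘ
        (#(orbit (Equiv.swap i j * g.perm) j),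
          ∑ y ∈ orbit (Equiv.swap i j * g.perm) j, g.col y + c) ::ₘ E := by
  obtain ⟨hU, hdis⟩ := split_pieces g.perm h hij
  have hcyc := split_cyc g.perm h hij
  set v := Equiv.swap i j * g.perm with hv
  have hvi : v⁻¹ i = g.perm⁻¹ j := by simp [hv]
  have hvj : v⁻¹ j = g.perm⁻¹ i := by simp [hv]
  have hi := self_mem_orbit v i
  have hj := self_mem_orbit v j
  have hji : j ∉ orbit v i := fun hh => Finset.disjoint_left.1 hdis hh hj
  have hij' : i ∉ orbit v j := fun hh => Finset.disjoint_left.1 hdis hi hh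
  have n1 : orbit v i ≠ orbit v j := fun e => hji (e ▸ hj)
  have hnot : ∀ x ∈ orbit g.perm i, ∀ D ∈ (cyc g.perm).erase (orbit g.perm i), x ∉ D := by
    intro x hx D hD hxD
    rw [mem_erase] at hD
    apply hD.1
    rw [← orbit_of_mem hD.2 hxD, ← orbit_of_mem (orbit_mem_cyc _ _) hx]
  have hi' : i ∈ orbit g.perm i := self_mem_orbit _ _
  have hj' : j ∈ orbit g.perm i := mem_orbit.2 h
  refine ⟨((cyc g.perm).erase (orbit g.perm i)).val.map (fC g), ?_, ?_⟩
  · unfold MG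
    rw [← Multiset.map_cons, erase_val, Multiset.cons_erase]
    exact orbit_mem_cyc _ _
  · unfold MG
    rw [trans_perm, ← hv, hcyc, insert_val_of_notMem, insert_val_of_notMem, Multiset.map_cons,
      Multiset.map_cons]
    · congr 1
      · unfold fC
        rw [sum_col_trans g i j c hij, ← hvi, ← hvj,
          if_neg (fun hh => hji (inv_mem_orbit.1 hh)), if_pos (inv_mem_orbit.2 hi)]
        simp
      · congr 1
        · unfold fC
          rw [sum_col_trans g i j c hij, ← hvi, ← hvj, 
            if_pos (inv_mem_orbit.2 hj), if_neg]
          · simp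
          · rw [inv_mem_orbit]; exact hij'
        · apply Multiset.map_congr rfl
          intro D hD
          have hD' : D ∈ (cyc g.perm).erase (orbit g.perm i) := hD
          unfold fC
          rw [sum_col_trans g i j c hij, if_neg, if_neg]
          · simp
          · exact hnot _ (inv_mem_orbit.2 hj') D hD'
          · exact hnot _ (inv_mem_orbit.2 hi') D hD'
    · intro hD
      exact hnot j hj' _ hD hj
    · rw [mem_insert, not_or]
      exact ⟨n1, fun hD => hnot i hi' _ hD hi⟩

/-- cut, with sizes -/
lemma cut_MG (g : GW m n) (i : Fin n) (s : ℕ) (h0 : 0 < s) (hs : s < per g.perm i) :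
    ∃ a : ZMod m, ∀ c, MG (transRefl i ((g.perm ^ s) i) c * g) =
      (s, a - c) ::ₘ ((fC g (orbit g.perm i)).1 - s, (fC g (orbit g.perm i)).2 - (a - c)) ::ₘ
        (MG g).erase (fC g (orbit g.perm i)) := by
  have hsc : g.perm.SameCycle i ((g.perm ^ s) i) := ⟨s, by simp⟩
  have hij : i ≠ (g.perm ^ s) i := by
    intro e
    have := pow_inj g.perm i (r := 0) (s := s) (per_pos _ _) hs (by simpa using e)
    omega
  obtain ⟨hU, hdis⟩ := split_pieces g.perm hsc hij
  refine ⟨∑ y ∈ orbit (Equiv.swap i ((g.perm ^ s) i) * g.perm) i, g.col y, fun c => ?_⟩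
  obtain ⟨E, h1, h2⟩ := split_MG g c hsc hij
  rw [h2, h1, Multiset.erase_cons_head]
  have hc := split_orbit_card g.perm i s h0 hs
  congr 1
  · rw [hc]
  · congr 1
    unfold fC
    simp only
    rw [hU, card_union_of_disjoint hdis, sum_union hdis, hc]
    congr 1
    · omega
    · ring

/-- join -/
lemma join_MG (g : GW m n) {i j : Fin n} (c : ZMod m) (h : ¬ g.perm.SameCycle i j) :
    MG (transRefl i j c * g) =
      ((fC g (orbit g.perm i)).1 + (fC g (orbit g.perm j)).1,
        (fC g (orbit g.perm i)).2 + (fC g (orbit g.perm j)).2) ::ₘ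
        ((MG g).erase (fC g (orbit g.perm i))).erase (fC g (orbit g.perm j)) := by
  have hij : i ≠ j := fun e => h (e ▸ Equiv.Perm.SameCycle.refl _ _)
  have hsc := merge_same g.perm h
  obtain ⟨hU, hdis⟩ := split_pieces (transRefl i j c * g).perm hsc hij
  obtain ⟨E, h1, h2⟩ := split_MG (transRefl i j c * g) c hsc hij
  have hgg : transRefl i j c * (transRefl i j c * g) = g := by
    rw [← mul_assoc, transRefl_mul_self i j c hij, one_mul]
  have hperm : Equiv.swap i j * (transRefl i j c * g).perm = g.perm := by
    rw [trans_perm, ← mul_assoc, Equiv.swap_mul_self, one_mul]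
  rw [hgg, hperm] at h2
  rw [hperm] at hU hdis
  have hi : i ∉ orbit g.perm j := fun e => h (mem_orbit.1 e).symm
  have hj : j ∉ orbit g.perm i := fun e => h (mem_orbit.1 e)
  have a1 : ∑ y ∈ orbit g.perm i, (transRefl i j c * g).col y - c
      = ∑ y ∈ orbit g.perm i, g.col y := by
    rw [sum_col_trans g i j c hij, if_pos (inv_mem_orbit.2 (self_mem_orbit _ _)), if_neg]
    · ring
    · rw [inv_mem_orbit]; exact hj
  have a2 : ∑ y ∈ orbit g.perm j, (transRefl i j c * g).col y + c
      = ∑ y ∈ orbit g.perm j, g.col y := by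
    rw [sum_col_trans g i j c hij, if_pos (inv_mem_orbit.2 (self_mem_orbit g.perm j)), if_neg]
    · ring
    · rw [inv_mem_orbit]; exact hi
  rw [a1, a2] at h2
  rw [h1, h2]
  unfold fC
  rw [Multiset.erase_cons_head, Multiset.erase_cons_head]
  congr 1
  rw [hU, card_union_of_disjoint hdis, sum_union hdis, ← a1, ← a2]
  congr 1
  ring

/-- recoloring -/
lemma diag_MG (g : GW m n) (i : Fin n) (c : ZMod m) :
    MG (diagRefl i c * g) = ((fC g (orbit g.perm i)).1, (fC g (orbit g.perm i)).2 + c) ::ₘ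
        (MG g).erase (fC g (orbit g.perm i)) := by
  have hp : (diagRefl i c * g).perm = g.perm := by simp [diagRefl]
  have hs : ∀ S : Finset (Fin n), ∑ y ∈ S, (diagRefl i c * g).col y
      = ∑ y ∈ S, g.col y + if g.perm⁻¹ i ∈ S then c else 0 := by
    intro S
    have : ∀ y, (diagRefl i c * g).col y = g.col y + (if g.perm⁻¹ i = y then c else 0) := by
      intro y
      simp only [mul_col, diagRefl, Equiv.Perm.inv_eq_iff_eq]
      by_cases h1 : g.perm y = i
      · rw [h1]; simp; ring
      · simp [h1, Ne.symm h1]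
    simp only [this, sum_add_distrib, sum_ite_eq]
  unfold MG
  rw [hp]
  have hC := orbit_mem_cyc g.perm i
  rw [← Multiset.map_erase_of_mem _ _ hC]
  conv_lhs => rw [← Multiset.cons_erase (s := (cyc g.perm).val) hC, Multiset.map_cons]
  congr 1
  · unfold fC
    rw [hs, if_pos (inv_mem_orbit.2 (self_mem_orbit _ _))]
  · apply Multiset.map_congr rfl
    intro D hD
    rw [← erase_val, mem_val, mem_erase] at hD
    unfold fC
    rw [hs, if_neg, add_zero]
    intro hh
    apply hD.1
    rw [← orbit_of_mem hD.2 hh, orbit_eq_iff]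
    exact (mem_orbit.1 (inv_mem_orbit.2 (self_mem_orbit g.perm i))).symm

lemma MG_one (g : GW m n) : (∀ x ∈ MG g, x = (1, 0)) ↔ g = 1 := by
  constructor
  · intro h
    have h1 : ∀ i, fC g (orbit g.perm i) = (1, 0) := fun i =>
      h _ (Multiset.mem_map_of_mem _ (orbit_mem_cyc g.perm i))
    have h2 : ∀ i, orbit g.perm i = {i} := by
      intro i
      have hc : #(orbit g.perm i) = 1 := congrArg Prod.fst (h1 i)
      obtain ⟨a, ha⟩ := card_eq_one.1 hc
      have := self_mem_orbit g.perm i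
      rw [ha, mem_singleton] at this
      rw [ha, this]
    ext i
    · have : g.perm i ∈ orbit g.perm i := apply_mem_orbit.2 (self_mem_orbit _ _)
      rw [h2, mem_singleton] at this
      rw [this]; rfl
    · have := congrArg Prod.snd (h1 i)
      unfold fC at this
      simp only at this
      rw [h2, sum_singleton] at this
      rw [this]; rfl
  · rintro rfl x hx
    obtain ⟨C, hC, rfl⟩ := Multiset.mem_map.1 hx
    obtain ⟨i, _, rfl⟩ := mem_image.1 (show C ∈ cyc _ from hC)
    have : orbit (1 : GW m n).perm i = {i} := by
      ext y
      rw [mem_orbit, mem_singleton, one_perm, Equiv.Perm.sameCycle_one]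
      exact eq_comm
    unfold fC
    rw [this]
    simp

lemma MG_pos (g : GW m n) (x : ℕ × ZMod m) (hx : x ∈ MG g) : 0 < x.1 := by
  obtain ⟨C, hC, rfl⟩ := Multiset.mem_map.1 hx
  obtain ⟨i, _, rfl⟩ := mem_image.1 (show C ∈ cyc _ from hC)
  exact card_pos.2 ⟨i, self_mem_orbit _ _⟩

lemma msz_MG (g : GW m n) : msz (MG g) = n := by
  unfold msz MG
  rw [Multiset.map_map]
  change ∑ C ∈ cyc g.perm, #C = n
  have h := sum_orbit g.perm (fun _ => 1)
  simp only [sum_const, card_univ, Fintype.card_fin, nsmul_eq_mul, mul_one] at h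
  exact_mod_cast h.symm

end ColorPart
section CountPart
open Finset GW

/-- lists of fixed length -/
def LL {G : Type*} [Group G] (R : Set G) (k : ℕ) (g : G) : Set (List G) :=
  {l | (∀ x ∈ l, x ∈ R) ∧ l.prod = g ∧ l.length = k}

/-- number of factorizations of fixed length, as a recursion -/
noncomputable def CN {G : Type*} [Group G] [Fintype G] (R : Set G) : ℕ → G → ℚ
  | 0, g => if g = 1 then 1 else 0
  | k + 1, g => ∑ t : G, if t ∈ R then CN R k (t⁻¹ * g) else 0

/-- finset version of LL -/
noncomputable def LF {G : Type*} [Group G] [Fintype G] (R : Set G) : ℕ → G → Finset (List G)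
  | 0, g => if g = 1 then {[]} else ∅
  | k + 1, g => (univ.filter (fun t : G => t ∈ R)).biUnion
      (fun t => (LF R k (t⁻¹ * g)).image (List.cons t))

lemma mem_LF {G : Type*} [Group G] [Fintype G] (R : Set G) (k : ℕ) :
    ∀ (g : G) (l : List G), l ∈ LF R k g ↔ l ∈ LL R k g := by
  induction k with
  | zero =>
    intro g l
    simp only [LF, LL, Set.mem_setOf_eq, List.length_eq_zero_iff]
    by_cases h : g = 1
    · rw [if_pos h, mem_singleton]
      constructor
      · rintro rfl; simp [h]
      · exact fun hh => hh.2.2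
    · rw [if_neg h]
      simp only [notMem_empty, false_iff]
      rintro ⟨_, h2, rfl⟩
      exact h (by simpa using h2.symm)
  | succ k ih =>
    intro g l
    simp only [LF, mem_biUnion, mem_filter, mem_univ, true_and, mem_image]
    constructor
    · rintro ⟨t, ht, l', hl', rfl⟩
      obtain ⟨h1, h2, h3⟩ := (ih _ _).1 hl'
      refine ⟨?_, ?_, ?_⟩
      · intro x hx
        rcases List.mem_cons.1 hx with rfl | hx
        · exact ht
        · exact h1 x hx
      · rw [List.prod_cons, h2]; group
      · simp [h3]
    · rintro ⟨h1, h2, h3⟩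
      obtain ⟨t, l', rfl⟩ := List.exists_cons_of_length_eq_add_one h3
      refine ⟨t, h1 t (by simp), l', (ih _ _).2 ⟨fun x hx => h1 x (by simp [hx]), ?_, ?_⟩, rfl⟩
      · rw [List.prod_cons] at h2; rw [← h2]; group
      · simpa using h3

lemma card_LF {G : Type*} [Group G] [Fintype G] (R : Set G) (k : ℕ) :
    ∀ g : G, ((LF R k g).card : ℚ) = CN R k g := by
  induction k with
  | zero => intro g; simp only [LF, CN]; split_ifs <;> simp
  | succ k ih =>
    intro g
    simp only [LF, CN]
    rw [card_biUnion, ← sum_filter]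
    · push_cast
      apply sum_congr rfl
      intro t _
      rw [card_image_of_injective _ (List.cons_injective), ih]
    · intro s _ t _ hst
      rw [Function.onFun, Finset.disjoint_left]
      intro l h1 h2
      obtain ⟨a, _, rfl⟩ := mem_image.1 h1
      obtain ⟨b, _, hb⟩ := mem_image.1 h2
      exact hst (List.cons.inj hb).1.symm

lemma ncard_LL {G : Type*} [Group G] [Fintype G] (R : Set G) (k : ℕ) (g : G) :
    ((LL R k g).ncard : ℚ) = CN R k g := by
  rw [← card_LF]
  have : LL R k g = ↑(LF R k g) := by
    ext l; rw [mem_coe, mem_LF]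
  rw [this, Set.ncard_coe_finset]

variable {m n : ℕ} [NeZero m]

instance : Finite (GW m n) :=
  Finite.of_injective (fun g => (g.perm, g.col)) (by
    intro g h e
    simp only [Prod.mk.injEq] at e
    exact GW.ext e.1 e.2)

noncomputable instance : Fintype (GW m n) := Fintype.ofFinite _

lemma transRefl_eq {i j i' j' : Fin n} {c c' : ZMod m} (hij : i ≠ j) (hij' : i' ≠ j')
    (h : transRefl i j c = transRefl i' j' c') :
    (i' = i ∧ j' = j ∧ c' = c) ∨ (i' = j ∧ j' = i ∧ c' = -c) := by
  have h1 : Equiv.swap i j = Equiv.swap i' j' := congrArg GW.perm h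
  have h2 : (transRefl i j c).col = (transRefl i' j' c').col := congrArg GW.col h
  have h3 := congrArg (fun e => e i) h1
  have h4 := congrFun h2 i
  simp only [transRefl, Equiv.swap_apply_left, if_true] at h3 h4
  by_cases e1 : i = i'
  · subst e1
    rw [Equiv.swap_apply_left] at h3
    left
    refine ⟨rfl, h3.symm, ?_⟩
    rw [if_pos rfl] at h4
    exact h4.symm
  · by_cases e2 : i = j'
    · subst e2
      rw [Equiv.swap_apply_right] at h3
      right
      refine ⟨h3.symm, rfl, ?_⟩
      rw [if_neg e1, if_pos rfl] at h4
      rw [h4, neg_neg]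
    · rw [Equiv.swap_apply_of_ne_of_ne e1 e2] at h3
      exact absurd h3.symm hij

lemma sum_trans (f : GW m n → ℚ) :
    ∑ i : Fin n, ∑ j : Fin n, ∑ c : ZMod m, (if i ≠ j then f (transRefl i j c) else 0)
      = 2 * ∑ t : GW m n, if t ∈ (reflGmm : Set (GW m n)) then f t else 0 := by
  have e1 : ∑ i : Fin n, ∑ j : Fin n, ∑ c : ZMod m, (if i ≠ j then f (transRefl i j c) else 0)
      = ∑ x ∈ (univ : Finset (Fin n × Fin n × ZMod m)).filter (fun x => x.1 ≠ x.2.1),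
        f (transRefl x.1 x.2.1 x.2.2) := by
    rw [sum_filter, Fintype.sum_prod_type]
    apply sum_congr rfl
    intro i _
    rw [Fintype.sum_prod_type]
  rw [e1, ← sum_filter, mul_sum,
    ← sum_fiberwise_of_maps_to (t := univ.filter (fun t : GW m n => t ∈ reflGmm))
      (g := fun x => transRefl x.1 x.2.1 x.2.2)]
  · apply sum_congr rfl
    intro t ht
    obtain ⟨i, j, c, hij, rfl⟩ := (mem_filter.1 ht).2
    have : ((univ : Finset (Fin n × Fin n × ZMod m)).filter (fun x => x.1 ≠ x.2.1)).filter
        (fun x => transRefl x.1 x.2.1 x.2.2 = transRefl i j c) = {(i, j, c), (j, i, -c)} := by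
      ext ⟨i', j', c'⟩
      simp only [mem_filter, mem_univ, true_and, mem_insert, mem_singleton, Prod.mk.injEq]
      constructor
      · rintro ⟨h1, h2⟩
        exact transRefl_eq hij h1 h2.symm
      · rintro (⟨rfl, rfl, rfl⟩ | ⟨rfl, rfl, rfl⟩)
        · exact ⟨hij, rfl⟩
        · refine ⟨hij.symm, ?_⟩
          rw [← transRefl_symm _ _ _ hij]
    rw [this, sum_pair, ← transRefl_symm _ _ _ hij]
    · ring
    · intro e
      exact hij (Prod.mk.inj e).1
  · intro x hx
    rw [mem_filter] at hx ⊢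
    exact ⟨mem_univ _, x.1, x.2.1, x.2.2, hx.2, rfl⟩

lemma sum_diag (f : GW m n → ℚ) :
    (∑ t : GW m n, if (∃ i c, c ≠ 0 ∧ t = diagRefl i c) then f t else 0)
    = ∑ i : Fin n, ∑ c ∈ (univ : Finset (ZMod m)).erase 0, f (diagRefl i c) := by
  rw [← sum_filter, ← sum_product']
  symm
  apply sum_nbij (fun x => diagRefl x.1 x.2)
  · rintro ⟨i, c⟩ hx
    rw [mem_product, mem_erase] at hx
    rw [mem_filter]
    exact ⟨mem_univ _, i, c, hx.2.1, rfl⟩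
  · rintro ⟨i, c⟩ hx ⟨i', c'⟩ hx' h
    rw [mem_coe, mem_product, mem_erase] at hx hx'
    have h1 := congrFun (congrArg GW.col h) i
    simp only [diagRefl, if_true] at h1
    by_cases e : i = i'
    · rw [if_pos e] at h1
      rw [e, h1]
    · rw [if_neg e] at h1
      exact absurd h1 hx.2.1
  · intro t ht
    rw [mem_coe, mem_filter] at ht
    obtain ⟨_, i, c, hc, rfl⟩ := ht
    refine ⟨(i, c), ?_, rfl⟩
    rw [mem_coe, mem_product, mem_erase]
    exact ⟨mem_univ _, hc, mem_univ _⟩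
  · intro x _; rfl

lemma msum_MG (g : GW m n) (f : ℕ × ZMod m → ℚ) :
    ((MG g).map f).sum = ∑ C ∈ cyc g.perm, f (fC g C) := by
  unfold MG
  rw [Multiset.map_map]; rfl

lemma erase_MG (g : GW m n) {C : Finset (Fin n)} (hC : C ∈ cyc g.perm) :
    (MG g).erase (fC g C) = ((cyc g.perm).erase C).val.map (fC g) := by
  unfold MG
  rw [← Multiset.map_erase_of_mem _ _ hC, erase_val]

lemma sum_orbit' (u : Equiv.Perm (Fin n)) (h : Fin n → ℚ) (f : Finset (Fin n) → ℚ)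
    (hf : ∀ i, h i = f (orbit u i)) : ∑ i, h i = ∑ C ∈ cyc u, (#C : ℚ) * f C := by
  rw [← sum_orbit]; exact sum_congr rfl fun i _ => hf i

lemma step_trans (F : Multiset (ℕ × ZMod m) → ℚ) (g : GW m n) :
    (∑ t : GW m n, if t ∈ (reflGmm : Set (GW m n)) then F (MG (t⁻¹ * g)) else 0)
    = ((MG g).map fun x => (x.1 : ℚ) * ∑ s ∈ Ico 1 x.1, ∑ e : ZMod m,
      F ((s, e) ::ₘ (x.1 - s, x.2 - e) ::ₘ (MG g).erase x)).sum / 2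
    + ((MG g).map fun x => (((MG g).erase x).map fun y => (x.1 : ℚ) * y.1 * m *
      F ((x.1 + y.1, x.2 + y.2) ::ₘ ((MG g).erase x).erase y)).sum).sum / 2 := by
  have h2 := sum_trans (fun t : GW m n => F (MG (t⁻¹ * g)))
  obtain ⟨Ψ, hΨ⟩ : ∃ Ψ : Finset (Fin n) → ℚ, ∀ C, Ψ C = 
      ∑ s ∈ Ico 1 (fC g C).1, ∑ e : ZMod m,
          F ((s, e) ::ₘ ((fC g C).1 - s, (fC g C).2 - e) ::ₘ (MG g).erase (fC g C))
        + ∑ D ∈ (cyc g.perm).erase C, (#D : ℚ) * (m *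
          F (((fC g C).1 + (fC g D).1, (fC g C).2 + (fC g D).2) ::ₘ
            ((MG g).erase (fC g C)).erase (fC g D))) := ⟨_, fun _ => rfl⟩
  have key : ∀ i : Fin n, ∑ j : Fin n, ∑ c : ZMod m,
      (if i ≠ j then F (MG ((transRefl i j c)⁻¹ * g)) else 0) = Ψ (orbit g.perm i) := by
    intro i
    rw [hΨ]
    obtain ⟨Φ, hΦ⟩ : ∃ Φ : Finset (Fin n) → ℚ, ∀ D, Φ D = if D ≠ orbit g.perm i then (m *
        F (((fC g (orbit g.perm i)).1 + (fC g D).1, (fC g (orbit g.perm i)).2 + (fC g D).2) ::ₘ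
          ((MG g).erase (fC g (orbit g.perm i))).erase (fC g D))) else 0 := ⟨_, fun _ => rfl⟩
    have a0 : ∀ j : Fin n, ∑ c : ZMod m,
        (if i ≠ j then F (MG ((transRefl i j c)⁻¹ * g)) else 0)
        = (if j ∈ (orbit g.perm i).erase i then ∑ c : ZMod m, F (MG (transRefl i j c * g)) else 0)
        + Φ (orbit g.perm j) := by
      intro j
      rw [hΦ]
      by_cases hij : i = j
      · subst hij; simp
      · simp only [if_pos hij, transRefl_inv _ _ _ hij]
        by_cases hsc : g.perm.SameCycle i j
        · rw [if_pos (mem_erase.2 ⟨Ne.symm hij, mem_orbit.2 hsc⟩),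
            if_neg (not_not.2 (orbit_eq_iff.2 hsc.symm)), add_zero]
        · rw [if_neg (fun e => hsc (mem_orbit.1 (mem_erase.1 e).2)),
            if_pos (fun e => hsc (orbit_eq_iff.1 e).symm), zero_add]
          simp only [join_MG g _ hsc]
          simp [ZMod.card]
    rw [sum_congr rfl (fun j _ => a0 j), sum_add_distrib, sum_orbit, ← sum_filter,
      filter_mem_eq_inter, univ_inter, sum_orbit_erase]
    congr 1
    · have : (fC g (orbit g.perm i)).1 = per g.perm i := card_orbit _ _
      rw [this]
      apply sum_congr rfl
      intro s hs
      rw [mem_Ico] at hs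
      obtain ⟨a, ha⟩ := cut_MG g i s hs.1 hs.2
      rw [this] at ha
      simp only [ha]
      exact Fintype.sum_equiv (Equiv.subLeft a) _ _ (fun c => rfl)
    · simp only [hΦ, mul_ite, mul_zero]
      rw [← sum_filter]
      apply sum_congr _ (fun _ _ => rfl)
      ext D
      simp [and_comm]
  rw [sum_orbit' g.perm _ _ key] at h2
  rw [msum_MG, msum_MG, ← add_div, eq_div_iff two_ne_zero, mul_comm, ← h2, ← sum_add_distrib]
  apply sum_congr rfl
  intro C hC
  rw [hΨ, mul_add]
  congr 1
  rw [erase_MG g hC, Multiset.map_map, mul_sum]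
  change _ = ∑ D ∈ (cyc g.perm).erase C, _
  apply sum_congr rfl
  intro D hD
  simp only [Function.comp]
  have : ((fC g C).1 : ℚ) = #C := rfl
  have : ((fC g D).1 : ℚ) = #D := rfl
  simp only [fC]
  ring

lemma step_diag (F : Multiset (ℕ × ZMod m) → ℚ) (g : GW m n) :
    (∑ t : GW m n, if (∃ i c, c ≠ 0 ∧ t = diagRefl i c) then F (MG (t⁻¹ * g)) else 0)
    = ((MG g).map fun x => (x.1 : ℚ) * ∑ e ∈ univ.erase x.2,
      F ((x.1, e) ::ₘ (MG g).erase x)).sum := by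
  rw [sum_diag (fun t => F (MG (t⁻¹ * g))), msum_MG]
  obtain ⟨Ψ, hΨ⟩ : ∃ Ψ : Finset (Fin n) → ℚ, ∀ C, Ψ C =
      ∑ e ∈ univ.erase (fC g C).2, F (((fC g C).1, e) ::ₘ (MG g).erase (fC g C)) :=
    ⟨_, fun _ => rfl⟩
  have key : ∀ i : Fin n, ∑ c ∈ (univ : Finset (ZMod m)).erase 0, F (MG ((diagRefl i c)⁻¹ * g))
      = Ψ (orbit g.perm i) := by
    intro i
    simp only [hΨ]
    simp only [diagRefl_inv, diag_MG]
    apply sum_nbij' (fun c => (fC g (orbit g.perm i)).2 + -c)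
      (fun e => (fC g (orbit g.perm i)).2 - e)
    · intro c; simp
    · intro c; simp [sub_eq_zero, eq_comm]
    · intro c; simp
    · intro c; simp
    · intro c _; rfl
  rw [sum_orbit' g.perm _ _ key]
  simp only [hΨ]
  rfl

lemma reflG1_disj (t : GW m n) (h : t ∈ (reflGmm : Set (GW m n))) :
    ¬ ∃ i c, c ≠ 0 ∧ t = diagRefl i c := by
  rintro ⟨i, c, hc, rfl⟩
  obtain ⟨i', j', c', hij, h⟩ := h
  have := congrArg (fun x => x.perm i') h
  simp [diagRefl, transRefl] at this
  exact hij this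

lemma CN_Gmm (k : ℕ) : ∀ g : GW m n, CN reflGmm k g = NN m 0 k (MG g) := by
  induction k with
  | zero => intro g; rw [CN, NN]; simp only [MG_one]
  | succ k ih =>
    intro g
    rw [CN, NN]
    simp only [ih]
    rw [step_trans (NN m 0 k) g]
    ring

lemma CN_G1 (k : ℕ) : ∀ g : GW m n, CN reflG1 k g = NN m 1 k (MG g) := by
  induction k with
  | zero => intro g; rw [CN, NN]; simp only [MG_one]
  | succ k ih =>
    intro g
    rw [CN, NN]
    simp only [ih]
    have e : ∀ t : GW m n, (if t ∈ (reflG1 : Set (GW m n)) then NN m 1 k (MG (t⁻¹ * g)) else 0)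
        = (if t ∈ (reflGmm : Set (GW m n)) then NN m 1 k (MG (t⁻¹ * g)) else 0)
        + (if (∃ i c, c ≠ 0 ∧ t = diagRefl i c) then NN m 1 k (MG (t⁻¹ * g)) else 0) := by
      intro t
      by_cases h : t ∈ (reflGmm : Set (GW m n))
      · have : t ∈ (reflG1 : Set (GW m n)) := Or.inl h
        rw [if_pos this, if_pos h, if_neg (reflG1_disj t h), add_zero]
      · rw [if_neg h, zero_add]
        have : t ∈ (reflG1 : Set (GW m n)) ↔ ∃ i c, c ≠ 0 ∧ t = diagRefl i c := by
          constructor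
          · rintro (h' | h')
            · exact absurd h' h
            · exact h'
          · exact Or.inr
        simp only [this]
    rw [sum_congr rfl (fun t _ => e t), sum_add_distrib, step_trans (NN m 1 k) g,
      step_diag (NN m 1 k) g, one_mul]

end CountPart
section Carter
open Finset GW

variable {n : ℕ}

/-- `v ↦ u v - v` for the permutation representation -/
noncomputable def DD (u : Equiv.Perm (Fin n)) : (Fin n → ℚ) →ₗ[ℚ] (Fin n → ℚ) :=
  LinearMap.funLeft ℚ ℚ (u⁻¹ : Equiv.Perm (Fin n)) - LinearMap.id

lemma DD_apply (u : Equiv.Perm (Fin n)) (v : Fin n → ℚ) (x : Fin n) :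
    DD u v x = v (u⁻¹ x) - v x := rfl

lemma DD_mul (s t : Equiv.Perm (Fin n)) (v : Fin n → ℚ) :
    DD (s * t) v = DD s (v + DD t v) + DD t v := by
  ext x
  simp only [DD_apply, Pi.add_apply, mul_inv_rev, Equiv.Perm.mul_apply]
  ring

lemma DD_one (v : Fin n → ℚ) : DD 1 v = 0 := by
  ext x; simp [DD_apply]

/-- span of the moved spaces -/
noncomputable def SP : List (Equiv.Perm (Fin n)) → Submodule ℚ (Fin n → ℚ)
  | [] => ⊥
  | t :: l => LinearMap.range (DD t) ⊔ SP l

lemma DD_mem_SP (l : List (Equiv.Perm (Fin n))) (t : Equiv.Perm (Fin n)) (ht : t ∈ l)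
    (v : Fin n → ℚ) : DD t v ∈ SP l := by
  induction l with
  | nil => simp at ht
  | cons s l ih =>
    rw [SP]
    rcases List.mem_cons.1 ht with rfl | ht
    · exact Submodule.mem_sup_left ⟨v, rfl⟩
    · exact Submodule.mem_sup_right (ih ht)

lemma DD_prod_mem_SP (l : List (Equiv.Perm (Fin n))) (v : Fin n → ℚ) :
    DD l.prod v ∈ SP l := by
  induction l with
  | nil => rw [List.prod_nil, DD_one]; exact Submodule.zero_mem _
  | cons s l ih =>
    rw [SP, List.prod_cons, DD_mul]
    exact Submodule.add_mem _ (Submodule.mem_sup_left ⟨_, rfl⟩) (Submodule.mem_sup_right ih)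

lemma finrank_DD (t : Equiv.Perm (Fin n)) (ht : t = 1 ∨ t.IsSwap) :
    Module.finrank ℚ (LinearMap.range (DD t)) ≤ if t ≠ 1 then 1 else 0 := by
  by_cases h1 : t = 1
  · rw [if_neg (not_not.2 h1)]
    have : DD t = 0 := by
      rw [h1]; exact LinearMap.ext fun v => DD_one v
    rw [this, LinearMap.range_zero, finrank_bot]
  · rw [if_pos h1]
    obtain ⟨i, j, hij, rfl⟩ := ht.resolve_left h1
    have hle : LinearMap.range (DD (Equiv.swap i j)) ≤
        Submodule.span ℚ {(Pi.single i 1 - Pi.single j 1 : Fin n → ℚ)} := by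
      rintro _ ⟨v, rfl⟩
      rw [Submodule.mem_span_singleton]
      refine ⟨v j - v i, ?_⟩
      ext x
      simp only [DD_apply, Equiv.swap_inv, Pi.smul_apply, Pi.sub_apply, smul_eq_mul]
      by_cases e1 : x = i
      · subst e1; simp [hij, Equiv.swap_apply_left]
      · by_cases e2 : x = j
        · subst e2; simp [hij.symm, Equiv.swap_apply_right]
        · rw [Equiv.swap_apply_of_ne_of_ne e1 e2]; simp [e1, e2]
    refine (Submodule.finrank_mono hle).trans ?_
    have := finrank_span_le_card (R := ℚ) ({(Pi.single i 1 - Pi.single j 1 : Fin n → ℚ)} : Set _)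
    simpa using this

/-- number of nontrivial factors -/
noncomputable def nsw : List (Equiv.Perm (Fin n)) → ℕ
  | [] => 0
  | t :: l => (if t ≠ 1 then 1 else 0) + nsw l

lemma nsw_le (l : List (Equiv.Perm (Fin n))) : nsw l ≤ l.length := by
  induction l with
  | nil => simp [nsw]
  | cons t l ih => rw [nsw, List.length_cons]; split_ifs <;> omega

lemma nsw_lt (l : List (Equiv.Perm (Fin n))) (h : 1 ∈ l) : nsw l < l.length := by
  induction l with
  | nil => simp at h
  | cons t l ih =>
    rw [nsw, List.length_cons]
    have := nsw_le l
    by_cases h1 : t = 1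
    · rw [if_neg (not_not.2 h1)]; omega
    · rcases List.mem_cons.1 h with h | h
      · exact absurd h.symm h1
      · have := ih h
        rw [if_pos h1]; omega

lemma finrank_SP (l : List (Equiv.Perm (Fin n))) (hl : ∀ t ∈ l, t = 1 ∨ t.IsSwap) :
    Module.finrank ℚ (SP l) ≤ nsw l := by
  induction l with
  | nil => rw [SP, finrank_bot]; exact Nat.zero_le _
  | cons t l ih =>
    rw [SP, nsw]
    refine (Submodule.finrank_add_le_finrank_add_finrank _ _).trans ?_
    exact add_le_add (finrank_DD t (hl t (by simp))) (ih fun s hs => hl s (by simp [hs]))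

lemma carter_fix (l : List (Equiv.Perm (Fin n))) (hl : ∀ t ∈ l, t = 1 ∨ t.IsSwap)
    (hr : nsw l ≤ Module.finrank ℚ (SP l)) (v : Fin n → ℚ) (hv : DD l.prod v = 0) :
    ∀ t ∈ l, DD t v = 0 := by
  induction l with
  | nil => simp
  | cons t l ih =>
    have hl' : ∀ s ∈ l, s = 1 ∨ s.IsSwap := fun s hs => hl s (by simp [hs])
    have h1 := finrank_DD t (hl t (by simp))
    have h2 := finrank_SP l hl'
    have h3 := Submodule.finrank_sup_add_finrank_inf_eq (LinearMap.range (DD t)) (SP l)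
    rw [SP, nsw] at hr
    have h4 : Module.finrank ℚ (LinearMap.range (DD t) ⊓ SP l : Submodule ℚ (Fin n → ℚ)) = 0 := by
      omega
    have h5 : nsw l ≤ Module.finrank ℚ (SP l) := by omega
    have h6 : LinearMap.range (DD t) ⊓ SP l = ⊥ := Submodule.finrank_eq_zero.1 h4
    rw [List.prod_cons, DD_mul] at hv
    have h7 : DD l.prod v ∈ LinearMap.range (DD t) ⊓ SP l := by
      refine ⟨⟨-(v + DD l.prod v), ?_⟩, DD_prod_mem_SP l v⟩
      rw [map_neg]
      exact (eq_neg_of_add_eq_zero_right hv).symm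
    rw [h6, Submodule.mem_bot] at h7
    rw [h7, add_zero, add_zero] at hv
    intro s hs
    rcases List.mem_cons.1 hs with rfl | hs
    · exact hv
    · exact ih hl' h5 h7 s hs

lemma DD_inv_of (u : Equiv.Perm (Fin n)) (v : Fin n → ℚ) (h : DD u v = 0) : DD u⁻¹ v = 0 := by
  have h1 := DD_mul u⁻¹ u v
  rw [inv_mul_cancel, DD_one, h, add_zero, add_zero] at h1
  exact h1.symm

lemma carter (hn : 0 < n) (l : List (Equiv.Perm (Fin n))) (hl : ∀ t ∈ l, t = 1 ∨ t.IsSwap)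
    (hc : nsw l ≤ n - 1) (hcl : Subgroup.closure {t | t ∈ l} = ⊤) (x : Fin n) :
    orbit l.prod x = univ := by
  -- all differences of basis vectors lie in the span
  have h1 : ∀ u : Equiv.Perm (Fin n), ∀ v, DD u v ∈ SP l := by
    intro u
    have hu : u ∈ Subgroup.closure {t | t ∈ l} := by rw [hcl]; trivial
    induction hu using Subgroup.closure_induction with
    | mem t ht => exact DD_mem_SP l t ht
    | one => intro v; rw [DD_one]; exact Submodule.zero_mem _
    | mul s t _ _ hs ht =>
      intro v
      rw [DD_mul]
      exact Submodule.add_mem _ (hs _) (ht _)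
    | inv s _ hs =>
      intro v
      have e : DD s⁻¹ v = - DD s (v + DD s⁻¹ v) := by
        have := DD_mul s s⁻¹ v
        rw [mul_inv_cancel, DD_one] at this
        exact eq_neg_of_add_eq_zero_right this.symm
      rw [e]
      exact Submodule.neg_mem _ (hs _)
  have h2 : (⊤ : Submodule ℚ (Fin n → ℚ)) ≤
      SP l ⊔ Submodule.span ℚ {(Pi.single x 1 : Fin n → ℚ)} := by
    rw [← (Pi.basisFun ℚ (Fin n)).span_eq, Submodule.span_le]
    rintro _ ⟨y, rfl⟩
    rw [Pi.basisFun_apply]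
    have e : (Pi.single y 1 : Fin n → ℚ)
        = DD (Equiv.swap x y) (Pi.single x 1) + Pi.single x 1 := by
      ext z
      simp only [Pi.add_apply, DD_apply, Equiv.swap_inv, sub_add_cancel, Pi.single_apply]
      congr 1
      rw [Equiv.swap_apply_eq_iff, Equiv.swap_apply_left]
    rw [e]
    exact Submodule.add_mem _ (Submodule.mem_sup_left (h1 _ _))
      (Submodule.mem_sup_right (Submodule.mem_span_singleton_self _))
  have h3 : n ≤ Module.finrank ℚ (SP l) + 1 := by
    have a1 := Submodule.finrank_mono h2
    rw [finrank_top, Module.finrank_fin_fun] at a1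
    have a2 := Submodule.finrank_add_le_finrank_add_finrank (SP l)
      (Submodule.span ℚ {(Pi.single x 1 : Fin n → ℚ)})
    have a3 := finrank_span_le_card (R := ℚ) ({(Pi.single x 1 : Fin n → ℚ)} : Set _)
    simp only [Set.toFinset_singleton, card_singleton] at a3
    omega
  set v : Fin n → ℚ := fun y => if y ∈ orbit l.prod x then 1 else 0 with hv
  have h4 : DD l.prod v = 0 := by
    ext y
    rw [DD_apply, hv]
    simp only [inv_mem_orbit, sub_self, Pi.zero_apply]
  have h5 := carter_fix l hl (by omega) v h4
  have h6 : ∀ u : Equiv.Perm (Fin n), DD u v = 0 := by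
    intro u
    have hu : u ∈ Subgroup.closure {t | t ∈ l} := by rw [hcl]; trivial
    induction hu using Subgroup.closure_induction with
    | mem t ht => exact h5 t ht
    | one => exact DD_one v
    | mul s t _ _ hs ht => rw [DD_mul, ht, add_zero, add_zero, hs]
    | inv s _ hs => exact DD_inv_of s v hs
  ext y
  simp only [mem_univ, iff_true]
  have h7 := congrFun (h6 (Equiv.swap x y)) y
  rw [DD_apply, Equiv.swap_inv, Equiv.swap_apply_right, hv] at h7
  simp only [self_mem_orbit, if_true, Pi.zero_apply] at h7
  by_contra hc
  rw [if_neg hc] at h7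
  norm_num at h7

end Carter
section Final
open Finset GW Comb

lemma rLen_le {G : Type*} [Group G] (R : Set G) (k : ℕ) (g : G) (h : (LL R k g).Nonempty) :
    rLen R g ≤ k := by
  obtain ⟨l, hl⟩ := h
  exact Nat.sInf_le ⟨l, hl⟩

lemma rLen_le_of_CN {G : Type*} [Group G] [Fintype G] (R : Set G) (k : ℕ) (g : G)
    (h : 0 < CN R k g) : rLen R g ≤ k := by
  apply rLen_le
  rw [← ncard_LL] at h
  apply Set.nonempty_of_ncard_ne_zero
  intro e
  rw [e] at h
  simp at h

lemma ncard_Red {G : Type*} [Group G] [Fintype G] (R : Set G) (k : ℕ) (g : G)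
    (h : k = rLen R g) : ((Red R g).ncard : ℚ) = CN R k g := by
  rw [← ncard_LL, h]; rfl

lemma prod_tau_pos (Z : Multiset ℕ) (hZ : ∀ p ∈ Z, 0 < p) : 0 < (Z.map tau).prod := by
  induction Z using Multiset.induction_on with
  | empty => simp
  | cons a s ih =>
    rw [Multiset.map_cons, Multiset.prod_cons]
    exact mul_pos (tau_pos a (hZ a (by simp))) (ih fun p hp => hZ p (by simp [hp]))

lemma fact_tau (N : ℕ) (hN : 0 < N) : ((N - 1).factorial : ℚ) * tau N = ((N ^ (N - 2) : ℕ) : ℚ) := by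
  unfold tau bet
  obtain ⟨M, rfl⟩ : ∃ M, N = M + 1 := ⟨N - 1, by omega⟩
  have : ((M + 1).factorial : ℚ) = (M + 1) * M.factorial := by
    rw [Nat.factorial_succ]; push_cast; ring
  rw [this, Nat.add_sub_cancel]
  have hM : (M.factorial : ℚ) ≠ 0 := by positivity
  have hM' : ((M : ℚ) + 1) ≠ 0 := by positivity
  rcases Nat.eq_zero_or_pos M with rfl | h
  · simp
  · obtain ⟨K, rfl⟩ : ∃ K, M = K + 1 := ⟨M - 1, by omega⟩
    rw [show K + 1 + 1 - 2 = K by omega]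
    push_cast at hM hM' ⊢
    field_simp
    ring

/-- part (i) in the wreath product with one color -/
lemma partA (N : ℕ) (g : GW 1 N) (h : N - 1 = rLen reflGmm g) :
    (Red reflGmm g).ncard = N ^ (N - 2) := by
  obtain ⟨Z, hZ⟩ : ∃ Z : Multiset ℕ, Z = (MG g).map Prod.fst := ⟨_, rfl⟩
  have hM : MG g = Z.map (zc 1) := by
    rw [hZ, Multiset.map_map]
    conv_lhs => rw [← Multiset.map_id (MG g)]
    apply Multiset.map_congr rfl
    intro x _
    exact Prod.ext rfl (Subsingleton.elim _ _)
  have hpos : ∀ p ∈ Z, 0 < p := by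
    intro p hp
    rw [hZ] at hp
    obtain ⟨x, hx, rfl⟩ := Multiset.mem_map.1 hp
    exact MG_pos g x hx
  have hsum : Z.sum = N := by rw [hZ]; exact msz_MG g
  have hcard := Multiset.card_nsmul_le_sum (s := Z) (a := 1) (fun x hx => hpos x hx)
  simp only [smul_eq_mul, mul_one] at hcard
  have hA := formA (m := 1) (δ := 0) (Z.sum - Multiset.card Z) Z hpos (by omega)
  rw [← hM, ← CN_Gmm] at hA
  have hle := rLen_le_of_CN (reflGmm : Set (GW 1 N)) _ g (by
    rw [hA]
    have := prod_tau_pos Z hpos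
    positivity)
  rw [← h] at hle
  have hc : ((Red reflGmm g).ncard : ℚ) = CN reflGmm (N - 1) g := ncard_Red _ _ g h
  rcases Nat.eq_zero_or_pos N with h0 | h0
  · have hZ0 : Z = 0 := by
      rw [← Multiset.card_eq_zero]; omega
    rw [hZ0] at hA
    subst h0
    simp at hA
    rw [show 0 - 1 = 0 from rfl, hA] at hc
    simpa using hc
  · have h1 : Multiset.card Z = 1 := by
      have : Multiset.card Z ≠ 0 := by
        intro e
        rw [Multiset.card_eq_zero] at e
        rw [e] at hsum
        simp at hsum
        omega
      omega
    obtain ⟨p, hp⟩ := Multiset.card_eq_one.1 h1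
    have hpN : p = N := by rw [hp] at hsum; simpa using hsum
    rw [h1, hsum, hp, hpN] at hA
    rw [hA] at hc
    simp only [Multiset.map_singleton, Multiset.prod_singleton] at hc
    rw [fact_tau N h0] at hc
    exact_mod_cast hc

lemma LL_equiv {G H : Type*} [Group G] [Group H] (e : G ≃* H) (R : Set G) (R' : Set H)
    (hR : ∀ x, x ∈ R ↔ e x ∈ R') (k : ℕ) (g : G) :
    LL R' k (e g) = List.map e '' LL R k g := by
  ext l
  constructor
  · rintro ⟨h1, h2, h3⟩
    refine ⟨l.map e.symm, ⟨?_, ?_, ?_⟩, ?_⟩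
    · intro x hx
      obtain ⟨y, hy, rfl⟩ := List.mem_map.1 hx
      rw [hR]; simpa using h1 y hy
    · apply e.injective
      rw [map_list_prod, List.map_map, ← h2]
      congr 1
      simp
    · simpa using h3
    · simp
  · rintro ⟨l, ⟨h1, h2, h3⟩, rfl⟩
    refine ⟨?_, ?_, ?_⟩
    · intro x hx
      obtain ⟨y, hy, rfl⟩ := List.mem_map.1 hx
      exact (hR y).1 (h1 y hy)
    · rw [← map_list_prod, h2]
    · simpa using h3

lemma rLen_equiv {G H : Type*} [Group G] [Group H] (e : G ≃* H) (R : Set G) (R' : Set H)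
    (hR : ∀ x, x ∈ R ↔ e x ∈ R') (g : G) : rLen R' (e g) = rLen R g := by
  have a1 : rLen R' (e g) = sInf {k | (LL R' k (e g)).Nonempty} := rfl
  have a2 : rLen R g = sInf {k | (LL R k g).Nonempty} := rfl
  rw [a1, a2]
  simp only [LL_equiv e R R' hR, Set.image_nonempty]

lemma Red_equiv {G H : Type*} [Group G] [Group H] (e : G ≃* H) (R : Set G) (R' : Set H)
    (hR : ∀ x, x ∈ R ↔ e x ∈ R') (g : G) : (Red R' (e g)).ncard = (Red R g).ncard := by
  have a1 : Red R' (e g) = LL R' (rLen R' (e g)) (e g) := rfl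
  have a2 : Red R g = LL R (rLen R g) g := rfl
  rw [a1, a2, rLen_equiv e R R' hR, LL_equiv e R R' hR]
  exact Set.ncard_image_of_injective _ (List.map_injective_iff.2 e.injective)

/-- the wreath product with one color is the symmetric group -/
def permEquiv (N : ℕ) : GW 1 N ≃* Equiv.Perm (Fin N) where
  toFun := GW.perm
  invFun u := ⟨u, 0⟩
  left_inv g := by
    ext k
    · rfl
    · exact Subsingleton.elim (α := ZMod 1) _ _
  right_inv u := rfl
  map_mul' x y := rfl

lemma permEquiv_refl (N : ℕ) (t : GW 1 N) :
    t ∈ (reflGmm : Set (GW 1 N)) ↔ permEquiv N t ∈ {t : Equiv.Perm (Fin N) | t.IsSwap} := by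
  constructor
  · rintro ⟨i, j, c, hij, rfl⟩
    exact ⟨i, j, hij, rfl⟩
  · rintro ⟨i, j, hij, h⟩
    refine ⟨i, j, 0, hij, ?_⟩
    apply (permEquiv N).injective
    rw [h]; rfl

lemma part1 (N : ℕ) (g : Equiv.Perm (Fin N))
    (h : N - 1 = rLen {t : Equiv.Perm (Fin N) | t.IsSwap} g) :
    (Red {t : Equiv.Perm (Fin N) | t.IsSwap} g).ncard = N ^ (N - 2) := by
  obtain ⟨g', rfl⟩ := (permEquiv N).surjective g
  rw [Red_equiv _ _ _ (permEquiv_refl N)]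
  apply partA
  rw [h, rLen_equiv _ _ _ (permEquiv_refl N)]

variable {m n : ℕ}

/-- underlying permutation -/
def permHom (m n : ℕ) : GW m n →* Equiv.Perm (Fin n) where
  toFun := GW.perm
  map_one' := rfl
  map_mul' _ _ := rfl

lemma trans_mem_Gmm (i j : Fin n) (c : ZMod m) (hij : i ≠ j) :
    transRefl i j c ∈ Gmm m n := by
  change ∑ k, (transRefl i j c).col k = 0
  have : ∀ k, (transRefl i j c).col k = (if k = i then c else 0) - (if k = j then c else 0) := by
    intro k
    simp only [transRefl]
    split_ifs with h1 h2 h2 <;> simp_all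
  simp [this]

lemma part2 (hm : 2 ≤ m) (hn : 1 ≤ n) (l : List (GW m n))
    (hl : ∀ t ∈ l, t ∈ (reflG1 : Set (GW m n))) (hlen : l.length = n)
    (hr : l.length = rLen (reflG1 : Set (GW m n)) l.prod)
    (hcl : Subgroup.closure {t | t ∈ l} = ⊤) :
    (Red (reflG1 : Set (GW m n)) l.prod).ncard = n ^ n := by
  haveI : NeZero m := ⟨by omega⟩
  haveI : Fact (1 < m) := ⟨hm⟩
  -- one of the factors is diagonal
  have hdiag : ∃ t ∈ l, t.perm = 1 := by
    by_contra hno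
    push Not at hno
    have hle : Subgroup.closure {t | t ∈ l} ≤ Gmm m n := by
      rw [Subgroup.closure_le]
      intro t ht
      rcases hl t ht with ⟨i, j, c, hij, rfl⟩ | ⟨i, c, _, rfl⟩
      · exact trans_mem_Gmm i j c hij
      · exact absurd rfl (hno _ ht)
    rw [hcl] at hle
    have h0 : diagRefl (⟨0, hn⟩ : Fin n) (1 : ZMod m) ∈ Gmm m n := hle trivial
    have h1 : ∑ k, (diagRefl (⟨0, hn⟩ : Fin n) (1 : ZMod m)).col k = 0 := h0
    simp [diagRefl] at h1
  have hlc : (l.map (permHom m n)).prod = l.prod.perm := (map_list_prod (permHom m n) l).symm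
  have horb : ∀ x, orbit l.prod.perm x = univ := by
    intro x
    rw [← hlc]
    apply carter (by omega)
    · intro t ht
      obtain ⟨s, hs, rfl⟩ := List.mem_map.1 ht
      rcases hl s hs with ⟨i, j, c, hij, rfl⟩ | ⟨i, c, _, rfl⟩
      · exact Or.inr ⟨i, j, hij, rfl⟩
      · exact Or.inl rfl
    · have := nsw_lt (l.map (permHom m n)) (by
        obtain ⟨t, ht, h1⟩ := hdiag
        exact List.mem_map.2 ⟨t, ht, h1⟩)
      rw [List.length_map] at this
      omega
    · have h1 := MonoidHom.map_closure (permHom m n) {t | t ∈ l}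
      have h2 : (permHom m n) '' {t | t ∈ l} = {t | t ∈ l.map (permHom m n)} := by
        ext u; simp
      rw [← h2, ← h1, hcl, ← MonoidHom.range_eq_map, MonoidHom.range_eq_top]
      intro u
      exact ⟨⟨u, 0⟩, rfl⟩
  have hcyc : cyc l.prod.perm = {univ} := by
    ext C
    rw [mem_singleton]
    constructor
    · intro hC
      obtain ⟨x, _, rfl⟩ := mem_image.1 hC
      exact horb x
    · rintro rfl
      rw [← horb ⟨0, hn⟩]
      exact orbit_mem_cyc _ _
  obtain ⟨d, hd⟩ : ∃ d : ZMod m, MG l.prod = {(n, d)} := by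
    refine ⟨∑ y, l.prod.col y, ?_⟩
    unfold MG
    rw [hcyc]
    simp [fC]
  have hd0 : d ≠ 0 := by
    rintro rfl
    have hA := formA (m := m) (δ := 1) (n - 1) {n} (by simp; omega) (by simp; omega)
    rw [Multiset.map_singleton, show zc m n = (n, 0) from rfl, ← hd, ← CN_G1] at hA
    have := rLen_le_of_CN (reflG1 : Set (GW m n)) _ l.prod (by
      rw [hA]
      have := prod_tau_pos {n} (by simp; omega)
      positivity)
    omega
  have hF := form1 (m := m) d hd0 n n 0 (by omega) (by simp) (by simp)
  rw [Multiset.map_zero, Multiset.cons_zero, ← hd, ← CN_G1,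
    ← ncard_Red reflG1 n l.prod (by omega)] at hF
  have : ((n.factorial : ℚ)) * bet n = ((n ^ n : ℕ) : ℚ) := by
    unfold bet
    have : (n.factorial : ℚ) ≠ 0 := by positivity
    push_cast
    field_simp
  simp only [Multiset.map_zero, Multiset.prod_zero, mul_one] at hF
  rw [this] at hF
  exact_mod_cast hF

lemma fact_HH (m a b : ℕ) (ha : 0 < a) (hb : 0 < b) :
    ((a + b).factorial : ℚ) * HH m a b
      = ((m * (a + b - 1) * Nat.choose (a + b - 2) (a - 1) * a ^ a * b ^ b : ℕ) : ℚ) := by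
  obtain ⟨x, rfl⟩ : ∃ x, a = x + 1 := ⟨a - 1, by omega⟩
  obtain ⟨y, rfl⟩ : ∃ y, b = y + 1 := ⟨b - 1, by omega⟩
  rw [show x + 1 + (y + 1) - 1 = x + y + 1 by omega, show x + 1 + (y + 1) - 2 = x + y by omega,
    Nat.add_sub_cancel, show x + 1 + (y + 1) = x + y + 1 + 1 by omega]
  have h1 : ((x + y).choose x : ℚ) * x.factorial * y.factorial = (x + y).factorial := by
    have h := Nat.add_choose_mul_factorial_mul_factorial x y
    rw [← Nat.choose_symm_add] at h
    exact_mod_cast h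
  unfold HH bet
  simp only [Nat.factorial_succ, Nat.cast_mul, Nat.cast_add, Nat.cast_one, Nat.cast_pow]
  rw [← h1]
  have e1 : (x.factorial : ℚ) ≠ 0 := by positivity
  have e2 : (y.factorial : ℚ) ≠ 0 := by positivity
  have e3 : (x : ℚ) + 1 ≠ 0 := by positivity
  have e4 : (y : ℚ) + 1 ≠ 0 := by positivity
  have e5 : (x : ℚ) + y + 1 + 1 ≠ 0 := by positivity
  have e6 : (x : ℚ) + 1 + (y + 1) = x + y + 1 + 1 := by ring
  rw [e6]
  field_simp

lemma part3 (a b : ℕ) (hm : 2 ≤ m) (hab : a + b = n) (g : GW m n)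
    (hr : n = rLen (reflGmm : Set (GW m n)) g) (hg : g ∈ Gmm m n) (x y : Fin n)
    (hxy : ¬ g.perm.SameCycle x y)
    (hz : ∀ z, g.perm.SameCycle x z ∨ g.perm.SameCycle y z)
    (ha : (orbit g.perm x).card = a) (hb : (orbit g.perm y).card = b)
    (hgen : AddSubgroup.closure ({cycColor g x, cycColor g y} : Set (ZMod m)) = ⊤) :
    (Red (reflGmm : Set (GW m n)) g).ncard
        = m * (n - 1) * Nat.choose (n - 2) (a - 1) * a ^ a * b ^ b := by
  haveI : NeZero m := ⟨by omega⟩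
  haveI : Fact (1 < m) := ⟨hm⟩
  have ha0 : 0 < a := by rw [← ha]; exact card_pos.2 ⟨x, self_mem_orbit _ _⟩
  have hb0 : 0 < b := by rw [← hb]; exact card_pos.2 ⟨y, self_mem_orbit _ _⟩
  have hne : orbit g.perm x ≠ orbit g.perm y := fun e => hxy (orbit_eq_iff.1 e)
  have hdis : Disjoint (orbit g.perm x) (orbit g.perm y) := by
    rw [Finset.disjoint_left]
    intro z h1 h2
    exact hxy ((mem_orbit.1 h1).trans (mem_orbit.1 h2).symm)
  have hun : orbit g.perm x ∪ orbit g.perm y = univ := by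
    ext z
    simp only [mem_union, mem_orbit, mem_univ, iff_true]
    exact hz z
  have hcol : cycColor g y = - cycColor g x := by
    have : ∑ k, g.col k = 0 := hg
    rw [← hun, sum_union hdis] at this
    exact eq_neg_of_add_eq_zero_right this
  have hc0 : cycColor g x ≠ 0 := by
    intro e
    rw [hcol, e] at hgen
    simp only [neg_zero, Set.pair_eq_singleton, AddSubgroup.closure_singleton_zero] at hgen
    have h1 : (1 : ZMod m) ∈ (⊥ : AddSubgroup (ZMod m)) := by rw [hgen]; trivial
    rw [AddSubgroup.mem_bot] at h1
    exact one_ne_zero h1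
  have hcyc : cyc g.perm = insert (orbit g.perm x) {orbit g.perm y} := by
    ext C
    rw [mem_insert, mem_singleton]
    constructor
    · intro hC
      obtain ⟨z, _, rfl⟩ := mem_image.1 hC
      rcases hz z with h | h
      · exact Or.inl (orbit_eq_iff.2 h.symm)
      · exact Or.inr (orbit_eq_iff.2 h.symm)
    · rintro (rfl | rfl) <;> exact orbit_mem_cyc _ _
  have hMG : MG g = (a, cycColor g x) ::ₘ (b, -cycColor g x) ::ₘ Multiset.map (zc m) 0 := by
    unfold MG
    rw [hcyc, insert_val_of_notMem (by rw [mem_singleton]; exact hne), Multiset.map_cons,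
      ← hcol, ← ha, ← hb]
    rfl
  have hF := formB (m := m) n (cycColor g x) hc0 a b 0 ha0 hb0 (by simp) (by simp [hab])
  rw [← hMG, ← CN_Gmm, ← ncard_Red reflGmm n g hr] at hF
  simp only [Multiset.map_zero, Multiset.prod_zero, mul_one] at hF
  have hH := fact_HH m a b ha0 hb0
  rw [hab] at hH
  rw [hH] at hF
  exact_mod_cast hF

end Final

open Comb GW in
/-- counting reduced reflection factorizations of quasi-Coxeter
elements: (i) in `S_n` (a quasi-Coxeter element being an element with a reduced
factorization into `n-1` transpositions generating `S_n`), `Fred(g) = n^{n-2}`;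
(ii) in `G(m,1,n)` with `m > 1`, `Fred(g) = n^n`; (iii) in `G(m,m,n)` with `m > 1`,
if the underlying permutation of `g` has two cycles, of lengths `a` and `b`, whose
colors generate `ℤ/mℤ`, then
`Fred(g) = m·(n-1)·(n-2 choose a-1)·a^a·b^b`. -/
theorem Fred_of_quasiCoxeter_infinite_families :
    -- (i) the symmetric group `S_n`
    (∀ (N : ℕ) (g : Equiv.Perm (Fin N)),
      (∃ l : List (Equiv.Perm (Fin N)), (∀ t ∈ l, t.IsSwap) ∧ l.prod = g ∧
          l.length = N - 1 ∧
          l.length = rLen {t : Equiv.Perm (Fin N) | t.IsSwap} g ∧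
          Subgroup.closure {t | t ∈ l} = ⊤) →
      (Red {t : Equiv.Perm (Fin N) | t.IsSwap} g).ncard = N ^ (N - 2)) ∧
    -- (ii) the group `G(m,1,n)`, `m > 1`
    (∀ (m n : ℕ), 2 ≤ m → 1 ≤ n → ∀ g : GW m n,
      (∃ l : List (GW m n), (∀ t ∈ l, t ∈ (reflG1 : Set (GW m n))) ∧ l.prod = g ∧
          l.length = n ∧ l.length = rLen (reflG1 : Set (GW m n)) g ∧
          Subgroup.closure {t | t ∈ l} = ⊤) →
      (Red (reflG1 : Set (GW m n)) g).ncard = n ^ n) ∧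
    -- (iii) the group `G(m,m,n)`, `m > 1`
    (∀ (m n a b : ℕ), 2 ≤ m → 1 ≤ n → a + b = n → ∀ g : GW m n,
      (∃ l : List (GW m n), (∀ t ∈ l, t ∈ (reflGmm : Set (GW m n))) ∧ l.prod = g ∧
          l.length = n ∧ l.length = rLen (reflGmm : Set (GW m n)) g ∧
          Subgroup.closure {t | t ∈ l} = Gmm m n) →
      (∃ x y : Fin n, ¬ g.perm.SameCycle x y ∧
          (∀ z, g.perm.SameCycle x z ∨ g.perm.SameCycle y z) ∧
          (orbit g.perm x).card = a ∧ (orbit g.perm y).card = b ∧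
          AddSubgroup.closure ({cycColor g x, cycColor g y} : Set (ZMod m)) = ⊤) →
      (Red (reflGmm : Set (GW m n)) g).ncard
        = m * (n - 1) * Nat.choose (n - 2) (a - 1) * a ^ a * b ^ b) := by
  refine ⟨?_, ?_, ?_⟩
  · rintro N g ⟨l, _, _, hlen, hr, _⟩
    exact part1 N g (hlen ▸ hr)
  · rintro m n hm hn g ⟨l, hl, rfl, hlen, hr, hcl⟩
    exact part2 hm hn l hl hlen hr hcl
  · rintro m n a b hm hn hab g ⟨l, hl, rfl, hlen, hr, hcl⟩ ⟨x, y, hxy, hz, ha, hb, hgen⟩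
    refine part3 a b hm hab l.prod (by omega) ?_ x y hxy hz ha hb hgen
    apply Subgroup.list_prod_mem
    intro t ht
    rw [← hcl]
    exact Subgroup.subset_closure ht
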